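/- arXiv:2403.13702 — 6 statements merged into one kernel-verified Lean document; each statement's English description precedes it below -/
import Mathlib

section
/- An ordered level graph 𝒢 = (G, γ, (≺_i)_{1≤i≤h}) admits an ordered level planar drawing if and only if there exists an exhaustive sweeping sequence for 𝒢 that uses every edge of G. -/
open scoped Classical

/-- A level graph: a finite directed graph with a surjective level assignment
`lvl : V → {1, …, h}` such that edges go strictly upwards. -/
structure OrderedLevelGraph (V : Type) [Fintype V] where
  h : ℕ
  Edge : V → V → Prop
  lvl : V → ℕ
  lvl_one_le : ∀ v, 1 ≤ lvl v
  lvl_le : ∀ v, lvl v ≤ h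
  lvl_surj : ∀ i, 1 ≤ i → i ≤ h → ∃ v, lvl v = i
  edge_lt : ∀ u v, Edge u v → lvl u < lvl v
  /-- the total order `≺ᵢ` on each level -/
  prec : ℕ → V → V → Prop
  prec_lvl : ∀ i u v, prec i u v → lvl u = i ∧ lvl v = i
  prec_irrefl : ∀ i v, ¬ prec i v v
  prec_trans : ∀ i a b c, prec i a b → prec i b c → prec i a c
  prec_total : ∀ i u v, lvl u = i → lvl v = i → u ≠ v → prec i u v ∨ prec i v u

/-- An ordered level planar drawing: x-coordinates for the vertices, a y-monotone
curve (given by its x-coordinate `f u v t` at height `t`) for every edge, no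
crossings, edges pass through no non-incident vertices, and the left-to-right
order on each level agrees with `≺ᵢ`. -/
structure OLPDrawing {V : Type} [Fintype V] (G : OrderedLevelGraph V) where
  x : V → ℝ
  f : V → V → ℝ → ℝ
  x_inj : ∀ u v, G.lvl u = G.lvl v → x u = x v → u = v
  f_cont : ∀ u v, G.Edge u v → ContinuousOn (f u v) (Set.Icc (G.lvl u : ℝ) (G.lvl v : ℝ))
  f_src : ∀ u v, G.Edge u v → f u v (G.lvl u : ℝ) = x u
  f_tgt : ∀ u v, G.Edge u v → f u v (G.lvl v : ℝ) = x v
  planar : ∀ u v u' v', G.Edge u v → G.Edge u' v' → (u, v) ≠ (u', v') →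
    ∀ t : ℝ, t ∈ Set.Icc (G.lvl u : ℝ) (G.lvl v : ℝ) →
      t ∈ Set.Icc (G.lvl u' : ℝ) (G.lvl v' : ℝ) → f u v t = f u' v' t →
      ∃ w, (w = u ∨ w = v) ∧ (w = u' ∨ w = v') ∧ t = (G.lvl w : ℝ) ∧ f u v t = x w
  no_through : ∀ u v w, G.Edge u v → w ≠ u → w ≠ v →
    G.lvl u ≤ G.lvl w → G.lvl w ≤ G.lvl v → f u v (G.lvl w : ℝ) ≠ x w
  prec_ok : ∀ i u v, G.prec i u v → x u < x v

variable {V : Type} [Fintype V]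

/-- `λᵢ`, the number of vertices on level `i`. -/
noncomputable def lam (G : OrderedLevelGraph V) (i : ℕ) : ℕ := Nat.card {v : V // G.lvl v = i}

/-- The (odd) position index representing vertex `v` on its level:
`2·rank(v) + 1`, where `rank v` is the number of vertices preceding `v`
in the total order of its level. -/
noncomputable def idx (G : OrderedLevelGraph V) (v : V) : ℕ :=
  2 * Nat.card {u : V // G.prec (G.lvl v) u v} + 1

/-- A separation: a choice of a position index on every level. -/
def IsSep (G : OrderedLevelGraph V) (s : ℕ → ℕ) : Prop := ∀ i, s i ≤ 2 * lam G i

/-- Vertex `v` is on the separation `s`. -/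
def OnSep (G : OrderedLevelGraph V) (s : ℕ → ℕ) (v : V) : Prop := s (G.lvl v) = idx G v

/-- `u` and `v` (with `lvl u < lvl v`) are consecutive on `s`: both are on `s`
and all intermediate levels carry a gap (an even index). -/
def ConsecOn (G : OrderedLevelGraph V) (s : ℕ → ℕ) (u v : V) : Prop :=
  OnSep G s u ∧ OnSep G s v ∧ G.lvl u < G.lvl v ∧
    ∀ j, G.lvl u < j → j < G.lvl v → s j % 2 = 0

/-- The separation `s` uses the edge `(u, v)`. -/
def UsesEdge (G : OrderedLevelGraph V) (s : ℕ → ℕ) (u v : V) : Prop :=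
  G.Edge u v ∧ ConsecOn G s u v

/-- A sweeping sequence: a finite sequence of separations that is
componentwise nondecreasing. -/
def IsSweep (G : OrderedLevelGraph V) (S : List (ℕ → ℕ)) : Prop :=
  (∀ s ∈ S, IsSep G s) ∧ S.Chain' fun s s' => ∀ i, s i ≤ s' i

/-- A sequence of separations is nice if each member arises from its
predecessor by incrementing exactly one component by 1. -/
def IsNice (S : List (ℕ → ℕ)) : Prop :=
  S.Chain' fun s s' => ∃ j, s' j = s j + 1 ∧ ∀ i, i ≠ j → s' i = s i

/-- An exhaustive sweeping sequence: nice, starting with `(0, …, 0)` and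
ending with `(2λ₁, …, 2λ_h)`. -/
def IsExhaustive (G : OrderedLevelGraph V) (S : List (ℕ → ℕ)) : Prop :=
  IsSweep G S ∧ IsNice S ∧ S ≠ [] ∧
    (∀ s ∈ S.head?, ∀ i, s i = 0) ∧
    (∀ s ∈ S.getLast?, ∀ i, s i = 2 * lam G i)

/-! ### Rankings of finite relations -/

/-- A finite asymmetric relation that is transitive across elements of locally minimal height
is realised by a real-valued ranking. -/
theorem exists_rank {α : Type*} (R : α → α → Prop) (top : α → ℕ)
    (asymm : ∀ a b, R a b → ¬ R b a)
    (trans : ∀ a b c, R a b → R b c → top b ≤ top a → top b ≤ top c → R a c)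
    (S : Finset α) :
    ∃ rank : α → ℝ, ∀ a ∈ S, ∀ b ∈ S, R a b → rank a < rank b := by
  induction S using Finset.induction_on_min_value top with
  | empty => exact ⟨fun _ => 0, by simp⟩
  | insert b S _ hmin ih =>
    obtain ⟨rank, hrank⟩ := ih
    obtain ⟨r, hlo, hhi⟩ := Order.exists_between_finsets
      (lo := (S.filter fun a => R a b).image rank) (hi := (S.filter fun c => R b c).image rank)
      (by
        simp only [Finset.mem_image, Finset.mem_filter]
        rintro _ ⟨a, ⟨ha, hab⟩, rfl⟩ _ ⟨c, ⟨hc, hbc⟩, rfl⟩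
        exact hrank a ha c hc (trans a b c hab hbc (hmin a ha) (hmin c hc)))
    refine ⟨Function.update rank b r, ?_⟩
    intro a ha c hc hac
    rcases eq_or_ne a b with rfl | hab <;> rcases eq_or_ne c a with rfl | hca
    · exact absurd hac (asymm _ _ hac)
    · have hcS := Finset.mem_of_mem_insert_of_ne hc hca
      simpa [hca] using hhi _ (Finset.mem_image_of_mem _ (Finset.mem_filter.2 ⟨hcS, hac⟩))
    · exact absurd hac (asymm _ _ hac)
    · have haS := Finset.mem_of_mem_insert_of_ne ha hab
      rcases eq_or_ne c b with rfl | hcb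
      · simpa [hab] using hlo _ (Finset.mem_image_of_mem _ (Finset.mem_filter.2 ⟨haS, hac⟩))
      · simpa [hab, hcb] using hrank a haS c (Finset.mem_of_mem_insert_of_ne hc hcb) hac

/-! ### Nice chains -/

/-- `s'` arises from `s` by incrementing exactly one component by 1. -/
def UnitStep (s s' : ℕ → ℕ) : Prop := ∃ j, s' j = s j + 1 ∧ ∀ i, i ≠ j → s' i = s i

theorem UnitStep.le {s s' : ℕ → ℕ} (hs : UnitStep s s') : s ≤ s' := by
  obtain ⟨j, hj, hne⟩ := hs
  intro i
  rcases eq_or_ne i j with rfl | h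
  · exact hj ▸ Nat.le_succ _
  · exact (hne i h).ge

theorem reflTransGen_unitStep {N : ℕ} {s t : ℕ → ℕ} (hst : s ≤ t) (ht : ∀ i, N ≤ i → t i = 0) :
    Relation.ReflTransGen UnitStep s t := by
  induction hn : ∑ i ∈ Finset.range N, (t i - s i) using Nat.strong_induction_on generalizing s with
  | _ n ih =>
    by_cases heq : s = t
    · exact heq ▸ .refl
    · obtain ⟨j, hj⟩ := Function.ne_iff.1 heq
      have hlt : s j < t j := lt_of_le_of_ne (hst j) hj
      have hjN : j < N := by
        by_contra h
        have := ht j (by omega)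
        omega
      refine .head (b := Function.update s j (s j + 1)) ⟨j, by simp, fun i hi => by simp [hi]⟩ ?_
      refine ih _ ?_ ?_ rfl
      · rw [← hn]
        refine Finset.sum_lt_sum (fun i _ => ?_) ⟨j, by simpa using hjN, ?_⟩
        · rcases eq_or_ne i j with rfl | h
          · simp; omega
          · simp [h]
        · simp; omega
      · intro i
        rcases eq_or_ne i j with rfl | h
        · simpa using hlt
        · simpa [h] using hst i

/-- There is a chain of unit steps from `s` to `t` through all the members of `M`. -/
def Threads (t s : ℕ → ℕ) (M : List (ℕ → ℕ)) : Prop :=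
  ∃ l, (s :: l).IsChain UnitStep ∧ (s :: l).getLast? = some t ∧ (∀ m ∈ s :: l, m ≤ t) ∧
    ∀ m ∈ M, m ∈ s :: l

theorem Threads.of_reflTransGen {t s s' : ℕ → ℕ} {M : List (ℕ → ℕ)}
    (hs : Relation.ReflTransGen UnitStep s s') (hM : Threads t s' M) : Threads t s M := by
  induction hs using Relation.ReflTransGen.head_induction_on with
  | refl => exact hM
  | head hstep _ ih =>
    obtain ⟨l, hc, hlast, hle, hmem⟩ := ih
    refine ⟨_ :: l, List.isChain_cons_cons.2 ⟨hstep, hc⟩, by simpa using hlast, ?_,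
      fun m hm => List.mem_cons_of_mem _ (hmem m hm)⟩
    intro m hm
    rcases List.mem_cons.1 hm with rfl | hm
    · exact hstep.le.trans (hle _ (by simp))
    · exact hle m hm

theorem threads_of_sorted {N : ℕ} {t s : ℕ → ℕ} {M : List (ℕ → ℕ)}
    (ht : ∀ i, N ≤ i → t i = 0) (hst : s ≤ t) (hM : ∀ m ∈ M, s ≤ m ∧ m ≤ t)
    (hsorted : M.Pairwise (· ≤ ·)) : Threads t s M := by
  induction M generalizing s with
  | nil =>
    exact .of_reflTransGen (reflTransGen_unitStep hst ht) ⟨[], by simp, by simp, by simp, by simp⟩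
  | cons m M ih =>
    obtain ⟨hsm, hmt⟩ := hM m (by simp)
    obtain ⟨hm, hsorted⟩ := List.pairwise_cons.1 hsorted
    obtain ⟨l, hc, hlast, hle, hmem⟩ :=
      ih hmt (fun m' hm' => ⟨hm m' hm', (hM m' (by simp [hm'])).2⟩) hsorted
    refine .of_reflTransGen (reflTransGen_unitStep (N := N) hsm fun i hi => ?_)
      ⟨l, hc, hlast, hle, ?_⟩
    · exact Nat.eq_zero_of_le_zero ((hmt i).trans (ht i hi).le)
    · intro m' hm'
      rcases List.mem_cons.1 hm' with rfl | hm'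
      · simp
      · exact hmem m' hm'

/-! ### Position indices -/

theorem lam_eq_zero {G : OrderedLevelGraph V} {i : ℕ} (hi : G.h < i) : lam G i = 0 := by
  have : IsEmpty {v : V // G.lvl v = i} := ⟨fun v => by have := G.lvl_le v; have := v.2; omega⟩
  simp [lam]

theorem idx_lt_idx {G : OrderedLevelGraph V} {u v : V} (huv : G.prec (G.lvl v) u v) :
    idx G u < idx G v := by
  have hl := (G.prec_lvl _ _ _ huv).1
  have : Nat.card {w : V // G.prec (G.lvl u) w u} < Nat.card {w : V // G.prec (G.lvl v) w v} := by
    simp only [Nat.card_eq_fintype_card, Fintype.card_subtype, hl]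
    refine Finset.card_lt_card (Finset.ssubset_iff_of_subset ?_ |>.2 ⟨u, ?_, ?_⟩)
    · intro w
      simpa using fun hw => G.prec_trans _ _ _ _ hw huv
    · simpa using huv
    · simpa using G.prec_irrefl _ _
  simp only [idx]
  omega

theorem idx_inj {G : OrderedLevelGraph V} {u v : V} (hl : G.lvl u = G.lvl v)
    (hi : idx G u = idx G v) : u = v := by
  by_contra hne
  rcases G.prec_total (G.lvl v) u v hl rfl hne with h | h
  · exact (idx_lt_idx h).ne hi
  · exact (idx_lt_idx (hl ▸ h)).ne' hi

theorem idx_odd (G : OrderedLevelGraph V) (v : V) : idx G v % 2 = 1 := by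
  simp [idx, Nat.add_mod]

theorem OnSep.odd {G : OrderedLevelGraph V} {s : ℕ → ℕ} {v : V} (hv : OnSep G s v) :
    s (G.lvl v) % 2 = 1 := by
  rw [OnSep] at hv
  rw [hv, idx_odd]

theorem OnSep.eq {G : OrderedLevelGraph V} {s s' : ℕ → ℕ} {u v : V} (hu : OnSep G s u)
    (hv : OnSep G s' v) (hl : G.lvl u = G.lvl v) (hs : s (G.lvl u) = s' (G.lvl u)) : u = v := by
  refine idx_inj hl ?_
  rw [← hu, ← hv, hs, hl]

theorem ConsecOn.odd_iff {G : OrderedLevelGraph V} {s : ℕ → ℕ} {u v : V} (he : ConsecOn G s u v)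
    {j : ℕ} (huj : G.lvl u ≤ j) (hjv : j ≤ G.lvl v) :
    s j % 2 = 1 ↔ j = G.lvl u ∨ j = G.lvl v := by
  constructor
  · intro hodd
    by_contra! hne
    have := he.2.2.2 j (by omega) (by omega)
    omega
  · rintro (rfl | rfl)
    · exact he.1.odd
    · exact he.2.1.odd

/-- Two pairs of consecutive vertices on a separation that overlap in more than a level agree. -/
theorem ConsecOn.unique {G : OrderedLevelGraph V} {s : ℕ → ℕ} {u v u' v' : V}
    (he : ConsecOn G s u v) (he' : ConsecOn G s u' v') (h : G.lvl u < G.lvl v')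
    (h' : G.lvl u' < G.lvl v) : u = u' ∧ v = v' := by
  have hu := he.1.odd
  have hv := he.2.1.odd
  have hu' := he'.1.odd
  have hv' := he'.2.1.odd
  have hlu : G.lvl u = G.lvl u' := by
    rcases lt_trichotomy (G.lvl u) (G.lvl u') with hlt | heq | hlt
    · have := he.2.2.2 _ hlt h'
      omega
    · exact heq
    · have := he'.2.2.2 _ hlt h
      omega
  have hlv : G.lvl v = G.lvl v' := by
    rcases lt_trichotomy (G.lvl v) (G.lvl v') with hlt | heq | hlt
    · have := he'.2.2.2 _ h' hlt
      omega
    · exact heq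
    · have := he.2.2.2 _ h hlt
      omega
  exact ⟨he.1.eq he'.1 hlu rfl, he.2.1.eq he'.2.1 hlv rfl⟩

/-! ### From a sweeping sequence to a drawing -/

/-- The horizontal position at level `j` of the `k`-th separation `s`: vertices sit at their
indices, whereas separations with larger `k` pass further to the right through a gap. -/
noncomputable def sepPos (N : ℕ) (k : ℕ) (s : ℕ → ℕ) (j : ℕ) : ℝ :=
  if s j % 2 = 1 then (s j : ℝ) else s j + (k : ℝ) / N

/-- The piecewise linear curve through the positions `sepPos N k s j` at heights `j ≤ h`. -/
noncomputable def sepCurve (h N : ℕ) (k : ℕ) (s : ℕ → ℕ) (t : ℝ) : ℝ :=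
  ∑ j ∈ Finset.range (h + 1), sepPos N k s j * max 0 (1 - |t - j|)

theorem continuous_sepCurve (h N k : ℕ) (s : ℕ → ℕ) : Continuous (sepCurve h N k s) := by
  unfold sepCurve
  fun_prop

theorem sepCurve_natCast {h n : ℕ} (hn : n ≤ h) (N k : ℕ) (s : ℕ → ℕ) :
    sepCurve h N k s n = sepPos N k s n := by
  rw [sepCurve, Finset.sum_eq_single n]
  · simp
  · intro j _ hj
    have : (1 : ℝ) ≤ |(n : ℝ) - j| := by
      have h1 : (1 : ℤ) ≤ |(n : ℤ) - j| := Int.one_le_abs (by omega)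
      exact_mod_cast h1
    rw [max_eq_left (by linarith), mul_zero]
  · intro hn'
    exact absurd (Finset.mem_range.2 (by omega)) hn'

theorem sepPos_le_and_eq {N k k' : ℕ} {s s' : ℕ → ℕ} (hkk : k < k') (hk' : k' < N) {j : ℕ}
    (hs : s j ≤ s' j) : sepPos N k s j ≤ sepPos N k' s' j ∧
      (sepPos N k s j = sepPos N k' s' j → s j = s' j ∧ s j % 2 = 1) := by
  have hN : (0 : ℝ) < N := by exact_mod_cast (by omega : 0 < N)
  have h0 : (0 : ℝ) ≤ (k : ℝ) / N := by positivity
  have h1 : (k : ℝ) / N < k' / N := by gcongr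
  have h2 : (k' : ℝ) / N < 1 := by rw [div_lt_one hN]; exact_mod_cast hk'
  have hcases : s j = s' j ∨ (s j : ℝ) + 1 ≤ s' j := by
    rcases hs.eq_or_lt with h | h
    · exact .inl h
    · exact .inr (by exact_mod_cast h)
  unfold sepPos
  rcases hcases with h | h
  · rw [← h]
    split_ifs with hp
    · simp [hp]
    · exact ⟨by linarith, fun hc => by linarith⟩
  · split_ifs <;> exact ⟨by linarith, fun hc => by linarith⟩

theorem sepCurve_eq {h N k k' : ℕ} {s s' : ℕ → ℕ} (hkk : k < k') (hk' : k' < N)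
    (hs : ∀ j, s j ≤ s' j) {t : ℝ} (ht : sepCurve h N k s t = sepCurve h N k' s' t) {j : ℕ}
    (hj : j ≤ h) (htj : |t - j| < 1) : s j = s' j ∧ s j % 2 = 1 := by
  have hle : ∀ i ∈ Finset.range (h + 1), sepPos N k s i * max 0 (1 - |t - i|) ≤
      sepPos N k' s' i * max 0 (1 - |t - i|) := fun i _ =>
    mul_le_mul_of_nonneg_right (sepPos_le_and_eq hkk hk' (hs i)).1 (le_max_left _ _)
  have heq := (Finset.sum_eq_sum_iff_of_le hle).1 ht j (Finset.mem_range.2 (by omega))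
  have hpos : max 0 (1 - |t - j|) ≠ 0 := (lt_max_of_lt_right (by linarith)).ne'
  exact (sepPos_le_and_eq hkk hk' (hs j)).2 (mul_right_cancel₀ hpos heq)

theorem sepPos_of_onSep {G : OrderedLevelGraph V} {s : ℕ → ℕ} {v : V} (hv : OnSep G s v)
    (N k : ℕ) : sepPos N k s (G.lvl v) = idx G v := by
  rw [sepPos, if_pos hv.odd, hv]

theorem onSep_of_sepPos {G : OrderedLevelGraph V} {s : ℕ → ℕ} {v : V} {N k : ℕ} (hk : k < N)
    (hv : sepPos N k s (G.lvl v) = idx G v) : OnSep G s v := by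
  unfold sepPos at hv
  split_ifs at hv with hp
  · exact_mod_cast hv
  · have hN : (0 : ℝ) < N := by exact_mod_cast (by omega : 0 < N)
    have h0 : (0 : ℝ) ≤ (k : ℝ) / N := by positivity
    have h2 : (k : ℝ) / N < 1 := by rw [div_lt_one hN]; exact_mod_cast hk
    have h3 : s (G.lvl v) ≤ idx G v := by
      have : (s (G.lvl v) : ℝ) ≤ idx G v := by linarith
      exact_mod_cast this
    have h4 : idx G v < s (G.lvl v) + 1 := by
      have : (idx G v : ℝ) < s (G.lvl v) + 1 := by linarith
      exact_mod_cast this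
    have := idx_odd G v
    omega

/-- Curves of separations that use distinct edges meet on both edges only in a common endpoint. -/
theorem exists_common_endpoint {G : OrderedLevelGraph V} {N k k' : ℕ} {s s' : ℕ → ℕ}
    {u v u' v' : V} (hkk : k < k' ∨ (k = k' ∧ s = s')) (hk' : k' < N) (hs : ∀ j, s j ≤ s' j)
    (he : ConsecOn G s u v) (he' : ConsecOn G s' u' v') (hne : (u, v) ≠ (u', v')) {t : ℝ}
    (ht : t ∈ Set.Icc (G.lvl u : ℝ) (G.lvl v)) (ht' : t ∈ Set.Icc (G.lvl u' : ℝ) (G.lvl v'))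
    (heq : sepCurve G.h N k s t = sepCurve G.h N k' s' t) :
    ∃ w, (w = u ∨ w = v) ∧ (w = u' ∨ w = v') ∧ t = G.lvl w := by
  have ht0 : 0 ≤ t := (Nat.cast_nonneg _).trans ht.1
  have meet : ∀ j : ℕ, G.lvl u ≤ j → j ≤ G.lvl v → G.lvl u' ≤ j → j ≤ G.lvl v' →
      s j = s' j → s j % 2 = 1 → ∃ w, (w = u ∨ w = v) ∧ (w = u' ∨ w = v') ∧ j = G.lvl w := by
    intro j h1 h2 h3 h4 hss hodd
    obtain ⟨w, hw, hws, hwj⟩ : ∃ w, (w = u ∨ w = v) ∧ OnSep G s w ∧ j = G.lvl w := by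
      rcases (he.odd_iff h1 h2).1 hodd with h | h
      · exact ⟨u, .inl rfl, he.1, h⟩
      · exact ⟨v, .inr rfl, he.2.1, h⟩
    obtain ⟨w', hw', hws', hwj'⟩ : ∃ w, (w = u' ∨ w = v') ∧ OnSep G s' w ∧ j = G.lvl w := by
      rcases (he'.odd_iff h3 h4).1 (hss ▸ hodd) with h | h
      · exact ⟨u', .inl rfl, he'.1, h⟩
      · exact ⟨v', .inr rfl, he'.2.1, h⟩
    have : w = w' := hws.eq hws' (by omega) (hwj ▸ hss)
    exact ⟨w, hw, this ▸ hw', hwj⟩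
  by_cases hint : ∃ j : ℕ, t = j
  · obtain ⟨j, rfl⟩ := hint
    simp only [Set.mem_Icc, Nat.cast_le] at ht ht'
    have key : s j = s' j ∧ s j % 2 = 1 := by
      rcases hkk with hkk | ⟨rfl, rfl⟩
      · exact sepCurve_eq hkk hk' hs heq (ht.2.trans (G.lvl_le v)) (by simp)
      · refine ⟨rfl, ?_⟩
        by_contra hodd
        have h1 := mt (he.odd_iff ht.1 ht.2).2 hodd
        have h2 := mt (he'.odd_iff ht'.1 ht'.2).2 hodd
        obtain ⟨rfl, rfl⟩ := he.unique he' (by omega) (by omega)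
        exact hne rfl
    obtain ⟨w, hw, hw', hj⟩ := meet j ht.1 ht.2 ht'.1 ht'.2 key.1 key.2
    exact ⟨w, hw, hw', by rw [hj]⟩
  · exfalso
    push Not at hint
    have hfl := Nat.floor_le ht0
    have hfl' := Nat.lt_floor_add_one t
    set j := ⌊t⌋₊ with hj
    have hlo : ∀ w, (G.lvl w : ℝ) ≤ t → G.lvl w ≤ j := fun w hw => Nat.le_floor hw
    have hhi : ∀ w, t ≤ (G.lvl w : ℝ) → j + 1 ≤ G.lvl w := fun w hw =>
      (Nat.floor_lt ht0).2 (lt_of_le_of_ne hw (hint _))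
    have h1 := hlo u ht.1
    have h2 := hhi v ht.2
    have h3 := hlo u' ht'.1
    have h4 := hhi v' ht'.2
    rcases hkk with hkk | ⟨rfl, rfl⟩
    · have hjt : (j : ℝ) < t := lt_of_le_of_ne hfl (hint j).symm
      have hvh := G.lvl_le v
      obtain ⟨a1, a2⟩ := sepCurve_eq hkk hk' hs heq (j := j) (by omega)
        (by rw [abs_lt]; constructor <;> linarith)
      obtain ⟨b1, b2⟩ := sepCurve_eq hkk hk' hs heq (j := j + 1) (by omega)
        (by push_cast; rw [abs_lt]; constructor <;> linarith)
      have c1 := (he.odd_iff h1 (by omega)).1 a2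
      have c2 := (he.odd_iff (by omega) h2).1 b2
      have d1 := (he'.odd_iff h3 (by omega)).1 (a1 ▸ a2)
      have d2 := (he'.odd_iff (by omega) h4).1 (b1 ▸ b2)
      have huj : G.lvl u = j := by omega
      have hvj : G.lvl v = j + 1 := by omega
      have hu : u = u' := he.1.eq he'.1 (by omega) (huj ▸ a1)
      have hv : v = v' := he.2.1.eq he'.2.1 (by omega) (hvj ▸ b1)
      exact hne (by rw [hu, hv])
    · obtain ⟨rfl, rfl⟩ := he.unique he' (by omega) (by omega)
      exact hne rfl

theorem nonempty_drawing_of_sweep {G : OrderedLevelGraph V} {S : List (ℕ → ℕ)}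
    (hS : IsSweep G S) (huse : ∀ u v, G.Edge u v → ∃ s ∈ S, UsesEdge G s u v) :
    Nonempty (OLPDrawing G) := by
  have hpw : S.Pairwise fun s s' => ∀ i, s i ≤ s' i := by
    have : IsTrans (ℕ → ℕ) (fun s s' => ∀ i, s i ≤ s' i) :=
      ⟨fun _ _ _ h1 h2 i => (h1 i).trans (h2 i)⟩
    exact List.isChain_iff_pairwise.1 hS.2
  have hidx : ∀ u v, ∃ k, G.Edge u v → ∃ hk : k < S.length, ConsecOn G S[k] u v := by
    intro u v
    by_cases he : G.Edge u v
    · obtain ⟨s, hs, -, hc⟩ := huse u v he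
      obtain ⟨k, hk, rfl⟩ := List.getElem_of_mem hs
      exact ⟨k, fun _ => ⟨hk, hc⟩⟩
    · exact ⟨0, fun h => absurd h he⟩
  choose k hk using hidx
  have hk' : ∀ u v, G.Edge u v → k u v < S.length ∧ ConsecOn G (S.getD (k u v) 0) u v := by
    intro u v he
    obtain ⟨h1, h2⟩ := hk u v he
    exact ⟨h1, by simpa [h1] using h2⟩
  have hmono : ∀ i j, i < j → j < S.length → ∀ l, S.getD i 0 l ≤ S.getD j 0 l := by
    intro i j hij hj
    have := List.pairwise_iff_getElem.1 hpw i j (hij.trans hj) hj hij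
    simpa [hj, hij.trans hj] using this
  have hval : ∀ u v w, OnSep G (S.getD (k u v) 0) w →
      sepCurve G.h S.length (k u v) (S.getD (k u v) 0) (G.lvl w) = idx G w := fun u v w hw => by
    rw [sepCurve_natCast (G.lvl_le w), sepPos_of_onSep hw]
  refine ⟨{
    x := fun v => idx G v
    f := fun u v => sepCurve G.h S.length (k u v) (S.getD (k u v) 0)
    x_inj := fun u v hl hx => idx_inj hl (by exact_mod_cast hx)
    f_cont := fun u v _ => (continuous_sepCurve _ _ _ _).continuousOn
    f_src := fun u v he => hval u v u (hk' u v he).2.1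
    f_tgt := fun u v he => hval u v v (hk' u v he).2.2.1
    planar := ?_
    no_through := ?_
    prec_ok := ?_ }⟩
  · intro u v u' v' he he' hne t ht ht' heq
    obtain ⟨h1, h2⟩ := hk' u v he
    obtain ⟨h1', h2'⟩ := hk' u' v' he'
    obtain ⟨w, hw, hw', htw⟩ : ∃ w, (w = u ∨ w = v) ∧ (w = u' ∨ w = v') ∧ t = G.lvl w := by
      rcases lt_trichotomy (k u v) (k u' v') with hlt | hkk | hlt
      · exact exists_common_endpoint (.inl hlt) h1' (hmono _ _ hlt h1') h2 h2' hne ht ht' heq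
      · exact exists_common_endpoint (.inr ⟨hkk, by rw [hkk]⟩) h1' (by simp [hkk]) h2 h2' hne
          ht ht' heq
      · obtain ⟨w, hw, hw', htw⟩ := exists_common_endpoint (.inl hlt) h1 (hmono _ _ hlt h1)
          h2' h2 hne.symm ht' ht heq.symm
        exact ⟨w, hw', hw, htw⟩
    refine ⟨w, hw, hw', htw, ?_⟩
    rw [htw]
    refine hval u v w ?_
    rcases hw with rfl | rfl
    · exact h2.1
    · exact h2.2.1
  · intro u v w he hwu hwv hl hl' heq
    obtain ⟨h1, h2⟩ := hk' u v he
    rw [sepCurve_natCast (G.lvl_le w)] at heq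
    have hw := onSep_of_sepPos h1 heq
    rcases (h2.odd_iff hl hl').1 hw.odd with h | h
    · exact hwu (hw.eq h2.1 h rfl)
    · exact hwv (hw.eq h2.2.1 h rfl)
  · intro i u v huv
    obtain ⟨-, rfl⟩ := G.prec_lvl i u v huv
    exact_mod_cast idx_lt_idx huv

/-! ### From a drawing to a sweeping sequence -/

namespace OLPDrawing

variable {G : OrderedLevelGraph V}

/-- The drawn objects: an edge `(u, v)`, or a vertex `v` encoded as `(v, v)`. -/
def IsElem (G : OrderedLevelGraph V) (a : V × V) : Prop := G.Edge a.1 a.2 ∨ a.1 = a.2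

/-- The curve of a drawn object; vertices are curves over a single height. -/
noncomputable def curve (D : OLPDrawing G) (a : V × V) (t : ℝ) : ℝ :=
  if a.1 = a.2 then D.x a.1 else D.f a.1 a.2 t

/-- The heights at which an object is drawn. -/
def dom (G : OrderedLevelGraph V) (a : V × V) : Set ℝ := Set.Icc (G.lvl a.1 : ℝ) (G.lvl a.2)

/-- At some height, `a` is drawn to the left of `b`. -/
def LeftOf (D : OLPDrawing G) (a b : V × V) : Prop :=
  IsElem G a ∧ IsElem G b ∧ ∃ t ∈ dom G a ∩ dom G b, D.curve a t < D.curve b t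

theorem curve_of_edge (D : OLPDrawing G) {u v : V} (he : G.Edge u v) (t : ℝ) :
    D.curve (u, v) t = D.f u v t := by
  have : u ≠ v := fun h => (h ▸ G.edge_lt u v he).ne rfl
  simp [curve, this]

theorem continuousOn_curve (D : OLPDrawing G) {a : V × V} (ha : IsElem G a) :
    ContinuousOn (D.curve a) (dom G a) := by
  obtain ⟨u, v⟩ := a
  rcases ha with he | (rfl : u = v)
  · exact (D.f_cont u v he).congr fun t _ => D.curve_of_edge he t
  · exact (continuousOn_const (c := D.x u)).congr fun t _ => by simp [curve]

theorem curve_endpoint (D : OLPDrawing G) {a : V × V} (ha : IsElem G a) {w : V}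
    (hw : w = a.1 ∨ w = a.2) : D.curve a (G.lvl w) = D.x w := by
  obtain ⟨u, v⟩ := a
  rcases ha with he | (rfl : u = v)
  · rw [D.curve_of_edge he]
    rcases hw with rfl | rfl
    · exact D.f_src _ _ he
    · exact D.f_tgt _ _ he
  · rcases hw with rfl | rfl <;> simp [curve]

theorem endpoint_mem_dom {a : V × V} (ha : IsElem G a) {w : V} (hw : w = a.1 ∨ w = a.2) :
    (G.lvl w : ℝ) ∈ dom G a := by
  have hle : G.lvl a.1 ≤ G.lvl a.2 := by
    rcases ha with he | he
    · exact (G.edge_lt _ _ he).le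
    · rw [he]
  rcases hw with rfl | rfl <;> simpa [dom] using hle

theorem exists_endpoint_of_curve_eq (D : OLPDrawing G) {a b : V × V} (ha : IsElem G a)
    (hb : IsElem G b) (hab : a ≠ b) {t : ℝ} (hta : t ∈ dom G a) (htb : t ∈ dom G b)
    (heq : D.curve a t = D.curve b t) : ∃ w, (w = a.1 ∨ w = a.2) ∧ t = G.lvl w := by
  obtain ⟨u, v⟩ := a
  obtain ⟨u', v'⟩ := b
  rcases ha with he | (rfl : u = v)
  · rw [D.curve_of_edge he] at heq
    rcases hb with he' | (rfl : u' = v')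
    · rw [D.curve_of_edge he'] at heq
      obtain ⟨w, hw, -, ht, -⟩ := D.planar u v u' v' he he' hab t hta htb heq
      exact ⟨w, hw, ht⟩
    · obtain rfl : t = G.lvl u' := le_antisymm htb.2 htb.1
      by_contra! hne
      have hx : D.curve (u', u') (G.lvl u') = D.x u' := by simp [curve]
      rw [hx] at heq
      simp only [dom, Set.mem_Icc, Nat.cast_le] at hta
      exact D.no_through u v u' he (fun h => hne u' (.inl h) rfl) (fun h => hne u' (.inr h) rfl)
        hta.1 hta.2 heq
  · exact ⟨u, .inl rfl, le_antisymm hta.2 hta.1⟩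

/-- Curves do not cross. -/
theorem curve_le_of_lt (D : OLPDrawing G) {a b : V × V} (ha : IsElem G a) (hb : IsElem G b)
    {t t' : ℝ} (ht : t ∈ dom G a ∩ dom G b) (ht' : t' ∈ dom G a ∩ dom G b)
    (hlt : D.curve a t < D.curve b t) : D.curve a t' ≤ D.curve b t' := by
  by_contra! hgt
  have hab : a ≠ b := by
    rintro rfl
    exact lt_irrefl _ hlt
  have hsub_a : Set.uIcc t t' ⊆ dom G a := Set.uIcc_subset_Icc ht.1 ht'.1
  have hsub_b : Set.uIcc t t' ⊆ dom G b := Set.uIcc_subset_Icc ht.2 ht'.2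
  obtain ⟨r, hr, heq⟩ := isPreconnected_uIcc.intermediate_value₂ Set.left_mem_uIcc
    Set.right_mem_uIcc ((D.continuousOn_curve ha).mono hsub_a)
    ((D.continuousOn_curve hb).mono hsub_b) hlt.le hgt.le
  obtain ⟨w, hw, hrw⟩ := D.exists_endpoint_of_curve_eq ha hb hab (hsub_a hr) (hsub_b hr) heq
  have hrt : r ≠ t := by
    rintro rfl
    exact hlt.ne heq
  have hrt' : r ≠ t' := by
    rintro rfl
    exact hgt.ne' heq
  obtain ⟨⟨h1, h2⟩, -⟩ := ht
  obtain ⟨⟨h3, h4⟩, -⟩ := ht'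
  have hr' : r ≤ t ∧ r ≤ t' ∨ t ≤ r ∧ t' ≤ r := by
    rcases hw with rfl | rfl
    · exact .inl ⟨hrw ▸ h1, hrw ▸ h3⟩
    · exact .inr ⟨hrw ▸ h2, hrw ▸ h4⟩
  rcases Set.mem_uIcc.1 hr with ⟨h, h'⟩ | ⟨h, h'⟩ <;> rcases hr' with ⟨g, g'⟩ | ⟨g, g'⟩
  · exact hrt (le_antisymm g h)
  · exact hrt' (le_antisymm h' g')
  · exact hrt' (le_antisymm g' h)
  · exact hrt (le_antisymm h' g)

theorem LeftOf.asymm (D : OLPDrawing G) {a b : V × V} (hab : D.LeftOf a b) : ¬ D.LeftOf b a := by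
  rintro ⟨-, -, t', ht', hlt'⟩
  obtain ⟨ha, hb, t, ht, hlt⟩ := hab
  exact hlt'.not_ge (D.curve_le_of_lt ha hb ht ht'.symm hlt)

theorem LeftOf.trans (D : OLPDrawing G) {a b c : V × V} (hab : D.LeftOf a b)
    (hbc : D.LeftOf b c) (hba : G.lvl b.2 ≤ G.lvl a.2) (hbc' : G.lvl b.2 ≤ G.lvl c.2) :
    D.LeftOf a c := by
  obtain ⟨ha, hb, t, ht, hlt⟩ := hab
  obtain ⟨-, hc, t', ht', hlt'⟩ := hbc
  have hba : (G.lvl b.2 : ℝ) ≤ G.lvl a.2 := by exact_mod_cast hba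
  have hbc' : (G.lvl b.2 : ℝ) ≤ G.lvl c.2 := by exact_mod_cast hbc'
  obtain ⟨⟨h1, h2⟩, h3, h4⟩ := ht
  obtain ⟨⟨h5, h6⟩, h7, h8⟩ := ht'
  have ma : max t t' ∈ dom G a := ⟨le_max_of_le_left h1, max_le h2 (h6.trans hba)⟩
  have mb : max t t' ∈ dom G b := ⟨le_max_of_le_left h3, max_le h4 h6⟩
  have mc : max t t' ∈ dom G c := ⟨le_max_of_le_right h7, max_le (h4.trans hbc') h8⟩
  have hle := D.curve_le_of_lt ha hb ⟨⟨h1, h2⟩, h3, h4⟩ ⟨ma, mb⟩ hlt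
  have hle' := D.curve_le_of_lt hb hc ⟨⟨h5, h6⟩, h7, h8⟩ ⟨mb, mc⟩ hlt'
  refine ⟨ha, hc, max t t', ⟨ma, mc⟩, ?_⟩
  rcases max_choice t t' with h | h
  · rw [h] at hle' ⊢
    exact hlt.trans_le hle'
  · rw [h] at hle ⊢
    exact hle.trans_lt hlt'

/-- The objects incident to a vertex, including the vertex itself. -/
def Incident (G : OrderedLevelGraph V) (w : V) (a : V × V) : Prop :=
  IsElem G a ∧ (w = a.1 ∨ w = a.2)

/-- The sweep progress of a vertex at time `r`: 0 before its first incident object,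
2 after the last one, and 1 in between. -/
noncomputable def progress (G : OrderedLevelGraph V) (rank : V × V → ℝ) (r : ℝ) (w : V) : ℕ :=
  (if ∃ a, Incident G w a ∧ rank a ≤ r then 1 else 0) +
    if ∀ a, Incident G w a → rank a < r then 1 else 0

/-- The separation at time `r` of the sweep that follows a ranking of the drawn objects. -/
noncomputable def sepAt (G : OrderedLevelGraph V) (rank : V × V → ℝ) (r : ℝ) (j : ℕ) : ℕ :=
  ∑ w with G.lvl w = j, progress G rank r w

theorem progress_mono (rank : V × V → ℝ) (w : V) : Monotone fun r => progress G rank r w := by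
  intro r r' hr
  refine add_le_add ?_ ?_
  · split_ifs with h h' <;> try simp
    obtain ⟨a, ha, har⟩ := h
    exact h' ⟨a, ha, har.trans hr⟩
  · split_ifs with h h' <;> try simp
    exact h' fun a ha => (h a ha).trans_le hr

theorem sepAt_mono (rank : V × V → ℝ) : Monotone (sepAt G rank) :=
  fun _ _ hr _ => Finset.sum_le_sum fun w _ => progress_mono rank w hr

theorem sepAt_le (rank : V × V → ℝ) (r : ℝ) (j : ℕ) : sepAt G rank r j ≤ 2 * lam G j := by
  have hle : ∀ w, progress G rank r w ≤ 2 := by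
    intro w
    unfold progress
    split_ifs <;> simp
  refine (Finset.sum_le_card_nsmul _ _ 2 fun w _ => hle w).trans ?_
  rw [lam, Nat.card_eq_fintype_card, Fintype.card_subtype, smul_eq_mul, mul_comm]

theorem progress_of_lt (D : OLPDrawing G) {rank : V × V → ℝ}
    (hrank : ∀ a b, D.LeftOf a b → rank a < rank b) {u v w : V} (he : G.Edge u v)
    (hw : (G.lvl w : ℝ) ∈ dom G (u, v)) (hlt : D.x w < D.f u v (G.lvl w)) :
    progress G rank (rank (u, v)) w = 2 := by
  have hall : ∀ a, Incident G w a → rank a < rank (u, v) := fun a ha =>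
    hrank _ _ ⟨ha.1, .inl he, _, ⟨endpoint_mem_dom ha.1 ha.2, hw⟩, by
      rwa [D.curve_endpoint ha.1 ha.2, D.curve_of_edge he]⟩
  have hinc : Incident G w (w, w) := ⟨.inr rfl, .inl rfl⟩
  rw [progress, if_pos ⟨_, hinc, (hall _ hinc).le⟩, if_pos hall]

theorem progress_of_gt (D : OLPDrawing G) {rank : V × V → ℝ}
    (hrank : ∀ a b, D.LeftOf a b → rank a < rank b) {u v w : V} (he : G.Edge u v)
    (hw : (G.lvl w : ℝ) ∈ dom G (u, v)) (hlt : D.f u v (G.lvl w) < D.x w) :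
    progress G rank (rank (u, v)) w = 0 := by
  have hall : ∀ a, Incident G w a → rank (u, v) < rank a := fun a ha =>
    hrank _ _ ⟨.inl he, ha.1, _, ⟨hw, endpoint_mem_dom ha.1 ha.2⟩, by
      rwa [D.curve_endpoint ha.1 ha.2, D.curve_of_edge he]⟩
  have hinc : Incident G w (w, w) := ⟨.inr rfl, .inl rfl⟩
  rw [progress, if_neg, if_neg]
  · exact fun h => (h _ hinc).not_gt (hall _ hinc)
  · rintro ⟨a, ha, har⟩
    exact har.not_gt (hall a ha)

theorem progress_of_incident {rank : V × V → ℝ} {w : V} {a : V × V} (ha : Incident G w a) :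
    progress G rank (rank a) w = 1 := by
  rw [progress, if_pos ⟨a, ha, le_rfl⟩, if_neg fun h => lt_irrefl _ (h a ha)]

theorem onSep_sepAt (D : OLPDrawing G) {rank : V × V → ℝ}
    (hrank : ∀ a b, D.LeftOf a b → rank a < rank b) {u v z : V} (he : G.Edge u v)
    (hz : z = u ∨ z = v) : OnSep G (sepAt G rank (rank (u, v))) z := by
  have hinc : Incident G z (u, v) := ⟨.inl he, hz⟩
  have hdom := endpoint_mem_dom hinc.1 hinc.2
  have hx : D.f u v (G.lvl z) = D.x z := by
    rw [← D.curve_of_edge he, D.curve_endpoint hinc.1 hinc.2]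
  have hterm : ∀ w ∈ Finset.univ.filter (fun w => G.lvl w = G.lvl z),
      progress G rank (rank (u, v)) w =
        2 * (if G.prec (G.lvl z) w z then 1 else 0) + if w = z then 1 else 0 := by
    intro w hw
    have hl : G.lvl w = G.lvl z := by simpa using hw
    rcases eq_or_ne w z with rfl | hne
    · rw [progress_of_incident hinc, if_neg (G.prec_irrefl _ _), if_pos rfl]
    · rw [if_neg hne]
      rcases G.prec_total (G.lvl z) w z hl rfl hne with h | h
      · rw [if_pos h, D.progress_of_lt hrank he (hl ▸ hdom) (by
          rw [hl, hx]
          exact D.prec_ok _ _ _ h)]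
      · rw [if_neg fun h' => G.prec_irrefl _ _ (G.prec_trans _ _ _ _ h h'),
          D.progress_of_gt hrank he (hl ▸ hdom) (by
            rw [hl, hx]
            exact D.prec_ok _ _ _ h)]
  rw [OnSep, sepAt, Finset.sum_congr rfl hterm, Finset.sum_add_distrib, ← Finset.mul_sum, idx]
  congr 1
  · rw [Finset.sum_boole, Finset.filter_filter, Nat.card_eq_fintype_card, Fintype.card_subtype,
      Nat.cast_id]
    congr 2
    ext w
    simpa using fun h => (G.prec_lvl _ _ _ h).1
  · simp

theorem usesEdge_sepAt (D : OLPDrawing G) {rank : V × V → ℝ}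
    (hrank : ∀ a b, D.LeftOf a b → rank a < rank b) {u v : V} (he : G.Edge u v) :
    UsesEdge G (sepAt G rank (rank (u, v))) u v := by
  refine ⟨he, D.onSep_sepAt hrank he (.inl rfl), D.onSep_sepAt hrank he (.inr rfl),
    G.edge_lt u v he, fun j huj hjv => ?_⟩
  refine Nat.mod_eq_zero_of_dvd (Finset.dvd_sum fun w hw => ?_)
  obtain rfl : G.lvl w = j := by simpa using hw
  have hdom : (G.lvl w : ℝ) ∈ dom G (u, v) := by
    simpa [dom] using And.intro huj.le hjv.le
  have hne : D.f u v (G.lvl w) ≠ D.x w := D.no_through u v w he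
    (fun h => huj.ne (h ▸ rfl)) (fun h => hjv.ne (h ▸ rfl)) huj.le hjv.le
  rcases hne.lt_or_gt with h | h
  · simp [D.progress_of_gt hrank he hdom h]
  · simp [D.progress_of_lt hrank he hdom h]

theorem exists_exhaustive_sweep (D : OLPDrawing G) :
    ∃ S : List (ℕ → ℕ), IsExhaustive G S ∧
      ∀ u v, G.Edge u v → ∃ s ∈ S, UsesEdge G s u v := by
  obtain ⟨rank, hrank⟩ := exists_rank D.LeftOf (fun a => G.lvl a.2)
    (fun _ _ => LeftOf.asymm D) (fun _ _ _ => LeftOf.trans D) Finset.univ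
  have hrank : ∀ a b, D.LeftOf a b → rank a < rank b := fun a b =>
    hrank a (Finset.mem_univ _) b (Finset.mem_univ _)
  obtain ⟨l, hc, hlast, hle, hmem⟩ := threads_of_sorted (N := G.h + 1)
    (t := fun i => 2 * lam G i) (s := fun _ => 0)
    (M := ((Finset.univ.image rank).sort (· ≤ ·)).map (sepAt G rank))
    (fun i hi => by simp [lam_eq_zero (G := G) (i := i) (by omega)])
    (fun _ => Nat.zero_le _)
    (by
      simp only [List.mem_map]
      rintro _ ⟨r, -, rfl⟩
      exact ⟨fun _ => Nat.zero_le _, sepAt_le rank r⟩)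
    (List.pairwise_map.2 ((Finset.pairwise_sort _ _).imp fun h => sepAt_mono rank h))
  refine ⟨_, ⟨⟨hle, hc.imp fun _ _ h => h.le⟩, hc, by simp, by simp, ?_⟩, ?_⟩
  · rw [hlast]
    simp
  · intro u v he
    exact ⟨_, hmem _ (List.mem_map_of_mem (by simp)), D.usesEdge_sepAt hrank he⟩

end OLPDrawing

/-- An ordered level graph admits an ordered level planar drawing
iff there is an exhaustive sweeping sequence for it using every edge. -/
theorem olp_iff_exhaustive_sweep (G : OrderedLevelGraph V) :
    Nonempty (OLPDrawing G) ↔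
      ∃ S : List (ℕ → ℕ), IsExhaustive G S ∧
        ∀ u v, G.Edge u v → ∃ s ∈ S, UsesEdge G s u v := by
  constructor
  · rintro ⟨D⟩
    exact D.exists_exhaustive_sweep
  · rintro ⟨S, hS, huse⟩
    exact nonempty_drawing_of_sweep hS.1 huse
end

section
/- Every proper ordered level planar graph is rigid, in the following sense: for every ordered level planar drawing (x, (f_e)) of a proper ordered level graph 𝒢 = (G, γ, (≺_i)), for any two distinct edges e = (u, v) and e′ = (u′, v′) with γ(u) = γ(u′) = i, and for every real t with i < t < i + 1, it holds that f_e(t) < f_{e′}(t) if and only if u ≺_i u′, or u = u′ and v ≺_{i+1} v′. In particular, all ordered level planar drawings of 𝒢 induce the same left-to-right order of edges between any two consecutive levels. -/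
open scoped Classical

variable {V : Type} [Fintype V]

/-- If two continuous functions on `[a, b]` do not meet in `(a, b)`, a strict inequality at one
point of `[a, b]` propagates to all of `(a, b)`. -/
lemma lt_on_Ioo_of_lt_of_ne {a b c t : ℝ} {f g : ℝ → ℝ}
    (hf : ContinuousOn f (Set.Icc a b)) (hg : ContinuousOn g (Set.Icc a b))
    (hne : ∀ s ∈ Set.Ioo a b, f s ≠ g s) (hc : c ∈ Set.Icc a b) (hfg : f c < g c)
    (ht : t ∈ Set.Ioo a b) : f t < g t := by
  by_contra! hle
  have hsub : Set.uIcc c t ⊆ Set.Icc a b := Set.uIcc_subset_Icc hc ⟨ht.1.le, ht.2.le⟩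
  obtain ⟨s, hs, hs'⟩ := isPreconnected_uIcc.intermediate_value₂ Set.left_mem_uIcc
    Set.right_mem_uIcc (hf.mono hsub) (hg.mono hsub) hfg.le hle
  have hsc : s ≠ c := by
    rintro rfl
    exact hfg.ne hs'
  refine hne s ?_ hs'
  obtain ⟨ha, hb⟩ := hc
  obtain ⟨ha', hb'⟩ := ht
  rcases Set.mem_uIcc.1 hs with ⟨h₁, h₂⟩ | ⟨h₁, h₂⟩
  · exact ⟨ha.trans_lt (h₁.lt_of_ne hsc.symm), h₂.trans_lt hb'⟩
  · exact ⟨ha'.trans_le h₁, (h₂.lt_of_ne hsc).trans_le hb⟩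

namespace OLPDrawing

/-- Distinct edges between the same two consecutive levels do not meet strictly between them. -/
lemma f_ne_of_mem_Ioo {G : OrderedLevelGraph V} (D : OLPDrawing G) {u v u' v' : V} {i : ℕ}
    (he : G.Edge u v) (he' : G.Edge u' v') (hne : (u, v) ≠ (u', v'))
    (hu : G.lvl u = i) (hv : G.lvl v = i + 1) (hu' : G.lvl u' = i) (hv' : G.lvl v' = i + 1)
    {t : ℝ} (ht : t ∈ Set.Ioo (i : ℝ) (i + 1)) : D.f u v t ≠ D.f u' v' t := by
  intro h
  have hIcc := Set.Ioo_subset_Icc_self ht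
  obtain ⟨w, hw, -, rfl, -⟩ := D.planar u v u' v' he he' hne t
    (by simpa [hu, hv] using hIcc) (by simpa [hu', hv'] using hIcc) h
  rcases hw with rfl | rfl
  · simp [hu] at ht
  · simp [hv] at ht

/-- The combinatorial order of two edges between the same two consecutive levels forces their
geometric order. -/
lemma f_lt_of_prec {G : OrderedLevelGraph V} (D : OLPDrawing G) {u v u' v' : V} {i : ℕ}
    (he : G.Edge u v) (he' : G.Edge u' v') (hne : (u, v) ≠ (u', v'))
    (hu : G.lvl u = i) (hv : G.lvl v = i + 1) (hu' : G.lvl u' = i) (hv' : G.lvl v' = i + 1)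
    (h : G.prec i u u' ∨ (u = u' ∧ G.prec (i + 1) v v'))
    {t : ℝ} (ht : t ∈ Set.Ioo (i : ℝ) (i + 1)) : D.f u v t < D.f u' v' t := by
  have hcont := D.f_cont u v he
  have hcont' := D.f_cont u' v' he'
  have hsrc := D.f_src u v he
  have hsrc' := D.f_src u' v' he'
  have htgt := D.f_tgt u v he
  have htgt' := D.f_tgt u' v' he'
  rw [hu, hv, Nat.cast_succ] at hcont
  rw [hu', hv', Nat.cast_succ] at hcont'
  rw [hu] at hsrc
  rw [hu'] at hsrc'
  rw [hv, Nat.cast_succ] at htgt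
  rw [hv', Nat.cast_succ] at htgt'
  have hdisj : ∀ s ∈ Set.Ioo (i : ℝ) (i + 1), D.f u v s ≠ D.f u' v' s :=
    fun s hs => D.f_ne_of_mem_Ioo he he' hne hu hv hu' hv' hs
  rcases h with h | ⟨-, h⟩
  · refine lt_on_Ioo_of_lt_of_ne hcont hcont' hdisj (c := i) (by simp) ?_ ht
    rw [hsrc, hsrc']
    exact D.prec_ok _ _ _ h
  · refine lt_on_Ioo_of_lt_of_ne hcont hcont' hdisj (c := i + 1) (by simp) ?_ ht
    rw [htgt, htgt']
    exact D.prec_ok _ _ _ h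

end OLPDrawing

/-- Every proper ordered level planar graph is rigid: in any
ordered level planar drawing, for two distinct edges `(u,v)` and `(u',v')`
starting on a common level `i`, and any height `i < t < i + 1`, the curve of
`(u,v)` is to the left of the curve of `(u',v')` at height `t` iff
`u ≺ᵢ u'`, or `u = u'` and `v ≺_{i+1} v'`.  In particular all ordered level
planar drawings induce the same left-to-right order of edges between
consecutive levels. -/
theorem proper_olp_rigid (G : OrderedLevelGraph V)
    (hproper : ∀ u v, G.Edge u v → G.lvl v = G.lvl u + 1)
    (D : OLPDrawing G) (u v u' v' : V)
    (he : G.Edge u v) (he' : G.Edge u' v') (hne : (u, v) ≠ (u', v'))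
    (hlvl : G.lvl u = G.lvl u') (t : ℝ)
    (ht1 : (G.lvl u : ℝ) < t) (ht2 : t < (G.lvl u : ℝ) + 1) :
    D.f u v t < D.f u' v' t ↔
      (G.prec (G.lvl u) u u' ∨ (u = u' ∧ G.prec (G.lvl u + 1) v v')) := by
  have hv := hproper u v he
  have hv' : G.lvl v' = G.lvl u + 1 := hlvl ▸ hproper u' v' he'
  refine ⟨fun hlt => ?_, fun h => D.f_lt_of_prec he he' hne rfl hv hlvl.symm hv' h ⟨ht1, ht2⟩⟩
  by_contra hnot
  refine hlt.not_gt (D.f_lt_of_prec he' he hne.symm hlvl.symm hv' rfl hv ?_ ⟨ht1, ht2⟩)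
  by_cases huu : u = u'
  · have hvv : v ≠ v' := fun h => hne (by rw [huu, h])
    exact .inr ⟨huu.symm, (G.prec_total _ v v' hv hv' hvv).resolve_left
      fun h => hnot (.inr ⟨huu, h⟩)⟩
  · exact .inl ((G.prec_total _ u u' rfl hlvl.symm huu).resolve_left fun h => hnot (.inl h))
end

section
/- Let 𝒢 be a constrained level graph of height 4 that contains two vertex-disjoint clips P_1 (a k_1-clip) and P_2 (a k_2-clip) as subgraphs, where the ordering constraints of both clips are among the constraints of 𝒢. Then in every constrained level planar drawing of 𝒢 the two clips do not cross: either on every level ℓ ∈ {1, 2, 3, 4} every vertex of P_1 on level ℓ has smaller x-coordinate than every vertex of P_2 on level ℓ, or on every level every vertex of P_2 on level ℓ has smaller x-coordinate than every vertex of P_1 on level ℓ. -/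
open scoped Classical

/-- A constrained level graph: a finite directed graph with a surjective level
assignment `lvl : V → {1, …, h}` such that edges go strictly upwards, together
with a partial order `≺ᵢ` on each level. -/
structure ConstrainedLevelGraph (V : Type) [Fintype V] where
  h : ℕ
  Edge : V → V → Prop
  lvl : V → ℕ
  lvl_one_le : ∀ v, 1 ≤ lvl v
  lvl_le : ∀ v, lvl v ≤ h
  lvl_surj : ∀ i, 1 ≤ i → i ≤ h → ∃ v, lvl v = i
  edge_lt : ∀ u v, Edge u v → lvl u < lvl v
  prec : ℕ → V → V → Prop
  prec_lvl : ∀ i u v, prec i u v → lvl u = i ∧ lvl v = i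
  prec_irrefl : ∀ i v, ¬ prec i v v
  prec_trans : ∀ i a b c, prec i a b → prec i b c → prec i a c

/-- A constrained level planar drawing. -/
structure CLPDrawing {V : Type} [Fintype V] (G : ConstrainedLevelGraph V) where
  x : V → ℝ
  f : V → V → ℝ → ℝ
  x_inj : ∀ u v, G.lvl u = G.lvl v → x u = x v → u = v
  f_cont : ∀ u v, G.Edge u v → ContinuousOn (f u v) (Set.Icc (G.lvl u : ℝ) (G.lvl v : ℝ))
  f_src : ∀ u v, G.Edge u v → f u v (G.lvl u : ℝ) = x u
  f_tgt : ∀ u v, G.Edge u v → f u v (G.lvl v : ℝ) = x v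
  planar : ∀ u v u' v', G.Edge u v → G.Edge u' v' → (u, v) ≠ (u', v') →
    ∀ t : ℝ, t ∈ Set.Icc (G.lvl u : ℝ) (G.lvl v : ℝ) →
      t ∈ Set.Icc (G.lvl u' : ℝ) (G.lvl v' : ℝ) → f u v t = f u' v' t →
      ∃ w, (w = u ∨ w = v) ∧ (w = u' ∨ w = v') ∧ t = (G.lvl w : ℝ) ∧ f u v t = x w
  no_through : ∀ u v w, G.Edge u v → w ≠ u → w ≠ v →
    G.lvl u ≤ G.lvl w → G.lvl w ≤ G.lvl v → f u v (G.lvl w : ℝ) ≠ x w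
  prec_ok : ∀ i u v, G.prec i u v → x u < x v

/-- A `k`-clip inside a constrained level graph: `2k+1` vertices
`u 0, …, u (2k)` on level 2, linearly ordered by constraints; for each even
index `2l` an edge to a private vertex `t l` on level 3; for each odd index
`2l+1` an edge from a private vertex `b l` on level 1; and a central vertex
`c` on level 4 joined from all the `t l`. -/
structure Clip {V : Type} [Fintype V] (G : ConstrainedLevelGraph V) (k : ℕ) where
  u : ℕ → V
  t : ℕ → V
  b : ℕ → V
  c : V
  lvl_u : ∀ j, j < 2 * k + 1 → G.lvl (u j) = 2
  lvl_t : ∀ l, l < k + 1 → G.lvl (t l) = 3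
  lvl_b : ∀ l, l < k → G.lvl (b l) = 1
  lvl_c : G.lvl c = 4
  cons : ∀ j j', j < j' → j' < 2 * k + 1 → G.prec 2 (u j) (u j')
  e_ut : ∀ l, l < k + 1 → G.Edge (u (2 * l)) (t l)
  e_bu : ∀ l, l < k → G.Edge (b l) (u (2 * l + 1))
  e_tc : ∀ l, l < k + 1 → G.Edge (t l) c
  t_inj : ∀ l l', l < k + 1 → l' < k + 1 → t l = t l' → l = l'
  b_inj : ∀ l l', l < k → l' < k → b l = b l' → l = l'

variable {V : Type} [Fintype V]

/-- The vertex set of a clip. -/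
def Clip.verts {G : ConstrainedLevelGraph V} {k : ℕ} (P : Clip G k) : Set V :=
  {v | (∃ j < 2 * k + 1, v = P.u j) ∨ (∃ l < k + 1, v = P.t l) ∨
       (∃ l < k, v = P.b l) ∨ v = P.c}

/-- Two vertex-disjoint edges spanning the same levels have the same left-to-right order
at their sources as at their targets. -/
theorem CLPDrawing.x_source_lt_iff_x_target_lt {G : ConstrainedLevelGraph V} (D : CLPDrawing G)
    {a b c d : V} (hab : G.Edge a b) (hcd : G.Edge c d) (hac : a ≠ c) (hbd : b ≠ d)
    (hs : G.lvl a = G.lvl c) (ht : G.lvl b = G.lvl d) :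
    D.x a < D.x c ↔ D.x b < D.x d := by
  have hlt := G.edge_lt a b hab
  have hle : (G.lvl a : ℝ) ≤ G.lvl b := by exact_mod_cast hlt.le
  have had : a ≠ d := by rintro rfl; omega
  have hbc : b ≠ c := by rintro rfl; omega
  have hcont : ContinuousOn (fun t => D.f a b t - D.f c d t)
      (Set.Icc (G.lvl a : ℝ) (G.lvl b : ℝ)) := by
    refine (D.f_cont a b hab).sub ?_
    rw [hs, ht]
    exact D.f_cont c d hcd
  have hne : (0 : ℝ) ∉ (fun t => D.f a b t - D.f c d t) ''
      Set.Icc (G.lvl a : ℝ) (G.lvl b : ℝ) := by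
    rintro ⟨t, hmem, h0⟩
    obtain ⟨w, hw, hw', -⟩ := D.planar a b c d hab hcd (fun h => hac (congrArg Prod.fst h)) t
      hmem (by rwa [hs, ht] at hmem) (sub_eq_zero.mp h0)
    rcases hw with rfl | rfl <;> rcases hw' with rfl | rfl <;> contradiction
  have hsrc : D.f a b (G.lvl a) - D.f c d (G.lvl a) = D.x a - D.x c := by
    rw [D.f_src a b hab, hs, D.f_src c d hcd]
  have htgt : D.f a b (G.lvl b) - D.f c d (G.lvl b) = D.x b - D.x d := by
    rw [D.f_tgt a b hab, ht, D.f_tgt c d hcd]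
  constructor <;> intro h <;> by_contra! h'
  · refine hne (intermediate_value_Icc hle hcont ?_)
    simp only [hsrc, htgt]
    constructor <;> linarith
  · refine hne (intermediate_value_Icc' hle hcont ?_)
    simp only [hsrc, htgt]
    constructor <;> linarith

namespace Clip

variable {G : ConstrainedLevelGraph V} {k : ℕ} (P : Clip G k)

theorem u_mem_verts {j : ℕ} (hj : j < 2 * k + 1) : P.u j ∈ P.verts := Or.inl ⟨j, hj, rfl⟩

theorem t_mem_verts {l : ℕ} (hl : l < k + 1) : P.t l ∈ P.verts := Or.inr (Or.inl ⟨l, hl, rfl⟩)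

theorem b_mem_verts {l : ℕ} (hl : l < k) : P.b l ∈ P.verts :=
  Or.inr (Or.inr (Or.inl ⟨l, hl, rfl⟩))

theorem c_mem_verts : P.c ∈ P.verts := Or.inr (Or.inr (Or.inr rfl))

theorem x_u_le (D : CLPDrawing G) {i j : ℕ} (hij : i ≤ j) (hj : j < 2 * k + 1) :
    D.x (P.u i) ≤ D.x (P.u j) := by
  rcases hij.eq_or_lt with rfl | h
  · exact le_rfl
  · exact (D.prec_ok 2 _ _ (P.cons i j h hj)).le

/-- The order of the central vertices of two disjoint clips determines the order of the
clips on every level. -/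
theorem x_lt_of_x_c_lt {m : ℕ} (Q : Clip G m) (D : CLPDrawing G)
    (hdisj : Disjoint P.verts Q.verts) (hc : D.x P.c < D.x Q.c)
    {p q : V} (hp : p ∈ P.verts) (hq : q ∈ Q.verts) (hlvl : G.lvl p = G.lvl q) :
    D.x p < D.x q := by
  have ht : ∀ i < k + 1, ∀ j < m + 1, D.x (P.t i) < D.x (Q.t j) := fun i hi j hj =>
    (D.x_source_lt_iff_x_target_lt (P.e_tc i hi) (Q.e_tc j hj)
      (hdisj.ne_of_mem (P.t_mem_verts hi) (Q.t_mem_verts hj))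
      (hdisj.ne_of_mem P.c_mem_verts Q.c_mem_verts)
      (by rw [P.lvl_t i hi, Q.lvl_t j hj]) (by rw [P.lvl_c, Q.lvl_c])).2 hc
  have hu : ∀ i < 2 * k + 1, ∀ j < 2 * m + 1, D.x (P.u i) < D.x (Q.u j) := by
    intro i hi j hj
    have hlast : D.x (P.u (2 * k)) < D.x (Q.u (2 * 0)) :=
      (D.x_source_lt_iff_x_target_lt (P.e_ut k (by omega)) (Q.e_ut 0 (by omega))
        (hdisj.ne_of_mem (P.u_mem_verts (by omega)) (Q.u_mem_verts (by omega)))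
        (hdisj.ne_of_mem (P.t_mem_verts (by omega)) (Q.t_mem_verts (by omega)))
        (by rw [P.lvl_u _ (by omega), Q.lvl_u _ (by omega)])
        (by rw [P.lvl_t _ (by omega), Q.lvl_t _ (by omega)])).2
        (ht k (by omega) 0 (by omega))
    calc D.x (P.u i) ≤ D.x (P.u (2 * k)) := P.x_u_le D (by omega) (by omega)
      _ < D.x (Q.u (2 * 0)) := hlast
      _ ≤ D.x (Q.u j) := Q.x_u_le D (by omega) hj
  have hb : ∀ i < k, ∀ j < m, D.x (P.b i) < D.x (Q.b j) := fun i hi j hj =>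
    (D.x_source_lt_iff_x_target_lt (P.e_bu i hi) (Q.e_bu j hj)
      (hdisj.ne_of_mem (P.b_mem_verts hi) (Q.b_mem_verts hj))
      (hdisj.ne_of_mem (P.u_mem_verts (by omega)) (Q.u_mem_verts (by omega)))
      (by rw [P.lvl_b i hi, Q.lvl_b j hj])
      (by rw [P.lvl_u _ (by omega), Q.lvl_u _ (by omega)])).2
      (hu _ (by omega) _ (by omega))
  rcases hp with ⟨i, hi, rfl⟩ | ⟨i, hi, rfl⟩ | ⟨i, hi, rfl⟩ | rfl <;>
    rcases hq with ⟨j, hj, rfl⟩ | ⟨j, hj, rfl⟩ | ⟨j, hj, rfl⟩ | rfl <;>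
    simp_all [P.lvl_u, P.lvl_t, P.lvl_b, P.lvl_c, Q.lvl_u, Q.lvl_t, Q.lvl_b, Q.lvl_c]

end Clip

/-- Two vertex-disjoint clips in a constrained level graph of
height 4 do not cross in any constrained level planar drawing: on every level,
either all vertices of the first clip are to the left of all vertices of the
second clip, or vice versa. -/
theorem clips_do_not_cross (G : ConstrainedLevelGraph V) (hh : G.h = 4)
    (k1 k2 : ℕ) (P1 : Clip G k1) (P2 : Clip G k2)
    (hdisj : P1.verts ∩ P2.verts = ∅)
    (D : CLPDrawing G) :
    (∀ p ∈ P1.verts, ∀ q ∈ P2.verts, G.lvl p = G.lvl q → D.x p < D.x q) ∨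
    (∀ p ∈ P2.verts, ∀ q ∈ P1.verts, G.lvl p = G.lvl q → D.x p < D.x q) := by
  have hd : Disjoint P1.verts P2.verts := Set.disjoint_iff_inter_eq_empty.2 hdisj
  have hne : D.x P1.c ≠ D.x P2.c := fun h =>
    hd.ne_of_mem P1.c_mem_verts P2.c_mem_verts
      (D.x_inj _ _ (by rw [P1.lvl_c, P2.lvl_c]) h)
  rcases hne.lt_or_gt with hc | hc
  · exact Or.inl fun _ hp _ hq hlvl => P1.x_lt_of_x_c_lt P2 D hd hc hp hq hlvl
  · exact Or.inr fun _ hp _ hq hlvl => P2.x_lt_of_x_c_lt P1 D hd.symm hc hp hq hlvl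
end

section
/- Let m, B ≥ 1 and let 𝒥 be the constrained level graph of height 4 consisting of a sequence of m mountain B-chains together with the single constraint w_0 ≺_4 w_m. Then 𝒥 admits a constrained level planar drawing, and this drawing is unique as an embedding: any two constrained level planar drawings of 𝒥 induce the same linear order (by x-coordinates) of the vertices on each of the four levels. -/
open scoped Classical

/-- The assertion that the constrained level graph `G` is (exactly) a sequence
of `m` mountain `B`-chains with the single constraint `w₀ ≺₄ w_m`.
The vertices are: grounds `g 0, …, g (m·B)` on level 1; for each mountain
`i < m·B` its left level-2 vertex `a i`, its peak `p i` on level 3 and its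
right level-2 vertex `d i` (mountain `i` is the path
`g i, a i, p i, d i, g (i+1)`); and for each wall `j ≤ m` its vertices
`w2 j`, `w3 j`, `w4 j` on levels 2, 3, 4, attached at ground `g (j·B)`. -/
structure MountainChainSeq {V : Type} [Fintype V]
    (G : ConstrainedLevelGraph V) (m B : ℕ) where
  g : ℕ → V
  a : ℕ → V
  p : ℕ → V
  d : ℕ → V
  w2 : ℕ → V
  w3 : ℕ → V
  w4 : ℕ → V
  lvl_g : ∀ i, i ≤ m * B → G.lvl (g i) = 1
  lvl_a : ∀ i, i < m * B → G.lvl (a i) = 2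
  lvl_p : ∀ i, i < m * B → G.lvl (p i) = 3
  lvl_d : ∀ i, i < m * B → G.lvl (d i) = 2
  lvl_w2 : ∀ j, j ≤ m → G.lvl (w2 j) = 2
  lvl_w3 : ∀ j, j ≤ m → G.lvl (w3 j) = 3
  lvl_w4 : ∀ j, j ≤ m → G.lvl (w4 j) = 4
  g_inj : ∀ i i', i ≤ m * B → i' ≤ m * B → g i = g i' → i = i'
  a_inj : ∀ i i', i < m * B → i' < m * B → a i = a i' → i = i'
  p_inj : ∀ i i', i < m * B → i' < m * B → p i = p i' → i = i'
  d_inj : ∀ i i', i < m * B → i' < m * B → d i = d i' → i = i'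
  w2_inj : ∀ j j', j ≤ m → j' ≤ m → w2 j = w2 j' → j = j'
  w3_inj : ∀ j j', j ≤ m → j' ≤ m → w3 j = w3 j' → j = j'
  w4_inj : ∀ j j', j ≤ m → j' ≤ m → w4 j = w4 j' → j = j'
  ad_ne : ∀ i i', i < m * B → i' < m * B → a i ≠ d i'
  aw_ne : ∀ i j, i < m * B → j ≤ m → a i ≠ w2 j
  dw_ne : ∀ i j, i < m * B → j ≤ m → d i ≠ w2 j
  pw_ne : ∀ i j, i < m * B → j ≤ m → p i ≠ w3 j
  cover : ∀ v : V,
    (∃ i ≤ m * B, v = g i) ∨ (∃ i < m * B, v = a i) ∨ (∃ i < m * B, v = p i) ∨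
    (∃ i < m * B, v = d i) ∨ (∃ j ≤ m, v = w2 j) ∨ (∃ j ≤ m, v = w3 j) ∨
    (∃ j ≤ m, v = w4 j)
  edge_iff : ∀ u v, G.Edge u v ↔
    ((∃ i < m * B, (u = g i ∧ v = a i) ∨ (u = a i ∧ v = p i) ∨
        (u = d i ∧ v = p i) ∨ (u = g (i + 1) ∧ v = d i)) ∨
     (∃ j ≤ m, (u = g (j * B) ∧ v = w2 j) ∨ (u = w2 j ∧ v = w3 j) ∨
        (u = w3 j ∧ v = w4 j)))
  prec_iff : ∀ i u v, G.prec i u v ↔ (i = 4 ∧ u = w4 0 ∧ v = w4 m)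

variable {V : Type} [Fintype V]

/-- `M.HasKey v k` says that `v` has horizontal position `k` in the canonical drawing. -/
def MountainChainSeq.HasKey {G : ConstrainedLevelGraph V} {m B : ℕ}
    (M : MountainChainSeq G m B) (v : V) (k : ℕ) : Prop :=
  (∃ i ≤ m * B, v = M.g i ∧ k = 3 * i + 1) ∨ (∃ i < m * B, v = M.a i ∧ k = 3 * i + 2) ∨
  (∃ i < m * B, v = M.p i ∧ k = 3 * i + 2) ∨ (∃ i < m * B, v = M.d i ∧ k = 3 * i + 3) ∨
  (∃ j ≤ m, v = M.w2 j ∧ k = 3 * (j * B) + 1) ∨ (∃ j ≤ m, v = M.w3 j ∧ k = 3 * (j * B) + 1) ∨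
  (∃ j ≤ m, v = M.w4 j ∧ k = 3 * (j * B) + 1)

namespace MountainChainSeq

variable {G : ConstrainedLevelGraph V} {m B : ℕ} (M : MountainChainSeq G m B)

theorem exists_hasKey (v : V) : ∃ k, M.HasKey v k := by
  rcases M.cover v with ⟨i, hi, h⟩ | ⟨i, hi, h⟩ | ⟨i, hi, h⟩ | ⟨i, hi, h⟩ | ⟨i, hi, h⟩ |
    ⟨i, hi, h⟩ | ⟨i, hi, h⟩
  · exact ⟨_, .inl ⟨i, hi, h, rfl⟩⟩
  · exact ⟨_, .inr (.inl ⟨i, hi, h, rfl⟩)⟩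
  · exact ⟨_, .inr (.inr (.inl ⟨i, hi, h, rfl⟩))⟩
  · exact ⟨_, .inr (.inr (.inr (.inl ⟨i, hi, h, rfl⟩)))⟩
  · exact ⟨_, .inr (.inr (.inr (.inr (.inl ⟨i, hi, h, rfl⟩))))⟩
  · exact ⟨_, .inr (.inr (.inr (.inr (.inr (.inl ⟨i, hi, h, rfl⟩)))))⟩
  · exact ⟨_, .inr (.inr (.inr (.inr (.inr (.inr ⟨i, hi, h, rfl⟩)))))⟩

/-- The horizontal position of a vertex in the canonical drawing. -/
noncomputable def key (v : V) : ℕ := Classical.choose (M.exists_hasKey v)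

theorem hasKey_key (v : V) : M.HasKey v (M.key v) := Classical.choose_spec (M.exists_hasKey v)

theorem key_g {i : ℕ} (hi : i ≤ m * B) : M.key (M.g i) = 3 * i + 1 := by
  rcases M.hasKey_key (M.g i) with
    ⟨k, hk, e, h⟩ | ⟨k, hk, e, h⟩ | ⟨k, hk, e, h⟩ | ⟨k, hk, e, h⟩ |
    ⟨k, hk, e, h⟩ | ⟨k, hk, e, h⟩ | ⟨k, hk, e, h⟩ <;>
  first
  | rw [h, M.g_inj _ _ hi hk e]
  | simpa [M.lvl_g, M.lvl_a, M.lvl_p, M.lvl_d, M.lvl_w2, M.lvl_w3, M.lvl_w4, hi, hk]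
      using congrArg G.lvl e

theorem key_a {i : ℕ} (hi : i < m * B) : M.key (M.a i) = 3 * i + 2 := by
  rcases M.hasKey_key (M.a i) with
    ⟨k, hk, e, h⟩ | ⟨k, hk, e, h⟩ | ⟨k, hk, e, h⟩ | ⟨k, hk, e, h⟩ |
    ⟨k, hk, e, h⟩ | ⟨k, hk, e, h⟩ | ⟨k, hk, e, h⟩ <;>
  first
  | rw [h, M.a_inj _ _ hi hk e]
  | exact (M.ad_ne _ _ hi hk e).elim
  | exact (M.aw_ne _ _ hi hk e).elim
  | simpa [M.lvl_g, M.lvl_a, M.lvl_p, M.lvl_d, M.lvl_w2, M.lvl_w3, M.lvl_w4, hi, hk]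
      using congrArg G.lvl e

theorem key_p {i : ℕ} (hi : i < m * B) : M.key (M.p i) = 3 * i + 2 := by
  rcases M.hasKey_key (M.p i) with
    ⟨k, hk, e, h⟩ | ⟨k, hk, e, h⟩ | ⟨k, hk, e, h⟩ | ⟨k, hk, e, h⟩ |
    ⟨k, hk, e, h⟩ | ⟨k, hk, e, h⟩ | ⟨k, hk, e, h⟩ <;>
  first
  | rw [h, M.p_inj _ _ hi hk e]
  | exact (M.pw_ne _ _ hi hk e).elim
  | simpa [M.lvl_g, M.lvl_a, M.lvl_p, M.lvl_d, M.lvl_w2, M.lvl_w3, M.lvl_w4, hi, hk]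
      using congrArg G.lvl e

theorem key_d {i : ℕ} (hi : i < m * B) : M.key (M.d i) = 3 * i + 3 := by
  rcases M.hasKey_key (M.d i) with
    ⟨k, hk, e, h⟩ | ⟨k, hk, e, h⟩ | ⟨k, hk, e, h⟩ | ⟨k, hk, e, h⟩ |
    ⟨k, hk, e, h⟩ | ⟨k, hk, e, h⟩ | ⟨k, hk, e, h⟩ <;>
  first
  | rw [h, M.d_inj _ _ hi hk e]
  | exact (M.ad_ne _ _ hk hi e.symm).elim
  | exact (M.dw_ne _ _ hi hk e).elim
  | simpa [M.lvl_g, M.lvl_a, M.lvl_p, M.lvl_d, M.lvl_w2, M.lvl_w3, M.lvl_w4, hi, hk]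
      using congrArg G.lvl e

theorem key_w2 {j : ℕ} (hj : j ≤ m) : M.key (M.w2 j) = 3 * (j * B) + 1 := by
  rcases M.hasKey_key (M.w2 j) with
    ⟨k, hk, e, h⟩ | ⟨k, hk, e, h⟩ | ⟨k, hk, e, h⟩ | ⟨k, hk, e, h⟩ |
    ⟨k, hk, e, h⟩ | ⟨k, hk, e, h⟩ | ⟨k, hk, e, h⟩ <;>
  first
  | rw [h, M.w2_inj _ _ hj hk e]
  | exact (M.aw_ne _ _ hk hj e.symm).elim
  | exact (M.dw_ne _ _ hk hj e.symm).elim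
  | simpa [M.lvl_g, M.lvl_a, M.lvl_p, M.lvl_d, M.lvl_w2, M.lvl_w3, M.lvl_w4, hj, hk]
      using congrArg G.lvl e

theorem key_w3 {j : ℕ} (hj : j ≤ m) : M.key (M.w3 j) = 3 * (j * B) + 1 := by
  rcases M.hasKey_key (M.w3 j) with
    ⟨k, hk, e, h⟩ | ⟨k, hk, e, h⟩ | ⟨k, hk, e, h⟩ | ⟨k, hk, e, h⟩ |
    ⟨k, hk, e, h⟩ | ⟨k, hk, e, h⟩ | ⟨k, hk, e, h⟩ <;>
  first
  | rw [h, M.w3_inj _ _ hj hk e]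
  | exact (M.pw_ne _ _ hk hj e.symm).elim
  | simpa [M.lvl_g, M.lvl_a, M.lvl_p, M.lvl_d, M.lvl_w2, M.lvl_w3, M.lvl_w4, hj, hk]
      using congrArg G.lvl e

theorem key_w4 {j : ℕ} (hj : j ≤ m) : M.key (M.w4 j) = 3 * (j * B) + 1 := by
  rcases M.hasKey_key (M.w4 j) with
    ⟨k, hk, e, h⟩ | ⟨k, hk, e, h⟩ | ⟨k, hk, e, h⟩ | ⟨k, hk, e, h⟩ |
    ⟨k, hk, e, h⟩ | ⟨k, hk, e, h⟩ | ⟨k, hk, e, h⟩ <;>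
  first
  | rw [h, M.w4_inj _ _ hj hk e]
  | simpa [M.lvl_g, M.lvl_a, M.lvl_p, M.lvl_d, M.lvl_w2, M.lvl_w3, M.lvl_w4, hj, hk]
      using congrArg G.lvl e

theorem key_inj (hB : 1 ≤ B) {u v : V} (hl : G.lvl u = G.lvl v) (hk : M.key u = M.key v) :
    u = v := by
  have hmul : ∀ j j' : ℕ, j * B = j' * B → j = j' := fun j j' h =>
    Nat.eq_of_mul_eq_mul_right hB h
  have hu := M.hasKey_key u
  have hv := M.hasKey_key v
  rw [← hk] at hv
  rcases hu with ⟨i, hi, rfl, h⟩ | ⟨i, hi, rfl, h⟩ | ⟨i, hi, rfl, h⟩ | ⟨i, hi, rfl, h⟩ |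
    ⟨i, hi, rfl, h⟩ | ⟨i, hi, rfl, h⟩ | ⟨i, hi, rfl, h⟩ <;>
  rcases hv with ⟨j, hj, rfl, h'⟩ | ⟨j, hj, rfl, h'⟩ | ⟨j, hj, rfl, h'⟩ | ⟨j, hj, rfl, h'⟩ |
    ⟨j, hj, rfl, h'⟩ | ⟨j, hj, rfl, h'⟩ | ⟨j, hj, rfl, h'⟩ <;>
  first
  | omega
  | rw [(by omega : i = j)]; done
  | rw [hmul i j (by omega)]; done
  | simp [M.lvl_g, M.lvl_a, M.lvl_p, M.lvl_w2, M.lvl_w3, M.lvl_w4, hi, hj] at hl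

theorem edge_cases {u v : V} (h : G.Edge u v) :
    (G.lvl u = 1 ∧ G.lvl v = 2 ∧ M.key u % 3 = 1 ∧ M.key u ≤ M.key v + 1 ∧
      M.key v ≤ M.key u + 1) ∨
    (G.lvl u = 2 ∧ G.lvl v = 3 ∧ ((M.key u % 3 = 0 ∧ M.key u = M.key v + 1) ∨
      (M.key u % 3 ≠ 0 ∧ M.key u = M.key v))) ∨
    (G.lvl u = 3 ∧ G.lvl v = 4 ∧ M.key u = M.key v) := by
  rcases (M.edge_iff u v).1 h with
    ⟨i, hi, ⟨rfl, rfl⟩ | ⟨rfl, rfl⟩ | ⟨rfl, rfl⟩ | ⟨rfl, rfl⟩⟩ |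
    ⟨j, hj, ⟨rfl, rfl⟩ | ⟨rfl, rfl⟩ | ⟨rfl, rfl⟩⟩
  · rw [M.lvl_g _ hi.le, M.lvl_a _ hi, M.key_g hi.le, M.key_a hi]; omega
  · rw [M.lvl_a _ hi, M.lvl_p _ hi, M.key_a hi, M.key_p hi]; omega
  · rw [M.lvl_d _ hi, M.lvl_p _ hi, M.key_d hi, M.key_p hi]; omega
  · rw [M.lvl_g _ hi, M.lvl_d _ hi, M.key_g hi, M.key_d hi]; omega
  · have hj' : j * B ≤ m * B := Nat.mul_le_mul_right B hj
    rw [M.lvl_g _ hj', M.lvl_w2 _ hj, M.key_g hj', M.key_w2 hj]; omega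
  · rw [M.lvl_w2 _ hj, M.lvl_w3 _ hj, M.key_w2 hj, M.key_w3 hj]; omega
  · rw [M.lvl_w3 _ hj, M.lvl_w4 _ hj, M.key_w3 hj, M.key_w4 hj]; omega

theorem lvl_edge (M : MountainChainSeq G m B) {u v : V} (h : G.Edge u v) : G.lvl v = G.lvl u + 1 := by
  have := M.edge_cases h; omega

theorem key_mono_edge {u v u' v' : V} (h : G.Edge u v) (h' : G.Edge u' v')
    (hl : G.lvl u = G.lvl u') (hk : M.key u < M.key u') : M.key v ≤ M.key v' := by
  have := M.edge_cases h; have := M.edge_cases h'; omega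

theorem edge_g_a {i : ℕ} (hi : i < m * B) : G.Edge (M.g i) (M.a i) :=
  (M.edge_iff _ _).2 (.inl ⟨i, hi, .inl ⟨rfl, rfl⟩⟩)

theorem edge_a_p {i : ℕ} (hi : i < m * B) : G.Edge (M.a i) (M.p i) :=
  (M.edge_iff _ _).2 (.inl ⟨i, hi, .inr (.inl ⟨rfl, rfl⟩)⟩)

theorem edge_d_p {i : ℕ} (hi : i < m * B) : G.Edge (M.d i) (M.p i) :=
  (M.edge_iff _ _).2 (.inl ⟨i, hi, .inr (.inr (.inl ⟨rfl, rfl⟩))⟩)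

theorem edge_g_d {i : ℕ} (hi : i < m * B) : G.Edge (M.g (i + 1)) (M.d i) :=
  (M.edge_iff _ _).2 (.inl ⟨i, hi, .inr (.inr (.inr ⟨rfl, rfl⟩))⟩)

theorem edge_g_w2 {j : ℕ} (hj : j ≤ m) : G.Edge (M.g (j * B)) (M.w2 j) :=
  (M.edge_iff _ _).2 (.inr ⟨j, hj, .inl ⟨rfl, rfl⟩⟩)

theorem edge_w2_w3 {j : ℕ} (hj : j ≤ m) : G.Edge (M.w2 j) (M.w3 j) :=
  (M.edge_iff _ _).2 (.inr ⟨j, hj, .inr (.inl ⟨rfl, rfl⟩)⟩)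

theorem edge_w3_w4 {j : ℕ} (hj : j ≤ m) : G.Edge (M.w3 j) (M.w4 j) :=
  (M.edge_iff _ _).2 (.inr ⟨j, hj, .inr (.inr ⟨rfl, rfl⟩)⟩)

/-- The straight-line drawing placing every vertex at its key. -/
noncomputable def drawing (hm : 1 ≤ m) (hB : 1 ≤ B) : CLPDrawing G where
  x v := M.key v
  f u v t := M.key u + (t - G.lvl u) * ((M.key v : ℝ) - M.key u)
  x_inj u v hl h := M.key_inj hB hl (by exact_mod_cast h)
  f_cont u v _ := by fun_prop
  f_src u v _ := by ring
  f_tgt u v h := by rw [M.lvl_edge h]; push_cast; ring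
  planar u v u' v' h h' hne t ht ht' heq := by
    have hl := M.lvl_edge h
    have hl' := M.lvl_edge h'
    rw [hl] at ht
    rw [hl'] at ht'
    obtain ⟨h1, h2⟩ := ht
    obtain ⟨h1', h2'⟩ := ht'
    push_cast at h2 h2'
    rcases lt_trichotomy (G.lvl u) (G.lvl u') with hlt | hlt | hlt
    · have hc : (G.lvl u : ℝ) + 1 ≤ G.lvl u' := by exact_mod_cast hlt
      have ht : t = G.lvl u' := by linarith
      have e : G.lvl v = G.lvl u' := by
        have : (G.lvl u' : ℝ) ≤ G.lvl u + 1 := by linarith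
        have : G.lvl u' ≤ G.lvl u + 1 := by exact_mod_cast this
        omega
      have ht2 : t - G.lvl u = 1 := by rw [ht, ← e, hl]; push_cast; ring
      have hk : M.key v = M.key u' := by
        rw [ht2, ht] at heq
        have : (M.key v : ℝ) = M.key u' := by linarith
        exact_mod_cast this
      refine ⟨v, .inr rfl, .inl (M.key_inj hB e hk), by rw [ht, e], ?_⟩
      rw [ht2]; ring
    · have hlv : G.lvl v = G.lvl v' := by omega
      rw [← hlt] at heq
      obtain ⟨s, hs⟩ : ∃ s : ℝ, s = t - G.lvl u := ⟨_, rfl⟩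
      rw [← hs] at heq ⊢
      have hs0 : 0 ≤ s := by linarith
      have hs1 : s ≤ 1 := by linarith
      have hkey : M.key u = M.key u' ∧ s = 0 ∨ M.key v = M.key v' ∧ s = 1 := by
        rcases lt_trichotomy (M.key u) (M.key u') with hk | hk | hk
        · have hkv := M.key_mono_edge h h' hlt hk
          have hk : (M.key u : ℝ) < M.key u' := by exact_mod_cast hk
          have hkv' : (M.key v : ℝ) ≤ M.key v' := by exact_mod_cast hkv
          have e1 : s = 1 := by nlinarith
          subst e1
          exact .inr ⟨by have : (M.key v : ℝ) = M.key v' := by linarith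
                         exact_mod_cast this, rfl⟩
        · left
          refine ⟨hk, ?_⟩
          have hv : M.key v ≠ M.key v' := fun hv => hne (by
            rw [M.key_inj hB hlt hk, M.key_inj hB hlv hv])
          have hv : (M.key v : ℝ) - M.key v' ≠ 0 := by
            rw [sub_ne_zero]; exact_mod_cast hv
          rw [← hk] at heq
          have : s * ((M.key v : ℝ) - M.key v') = 0 := by linarith
          exact (mul_eq_zero.1 this).resolve_right hv
        · have hkv := M.key_mono_edge h' h hlt.symm hk
          have hk : (M.key u' : ℝ) < M.key u := by exact_mod_cast hk
          have hkv' : (M.key v' : ℝ) ≤ M.key v := by exact_mod_cast hkv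
          have e1 : s = 1 := by nlinarith
          subst e1
          exact .inr ⟨by have : (M.key v : ℝ) = M.key v' := by linarith
                         exact_mod_cast this, rfl⟩
      rcases hkey with ⟨hk, h0⟩ | ⟨hk, h0⟩
      · exact ⟨u, .inl rfl, .inl (M.key_inj hB hlt hk), by linarith, by rw [h0]; ring⟩
      · exact ⟨v, .inr rfl, .inr (M.key_inj hB hlv hk), by rw [hl]; push_cast; linarith,
          by rw [h0]; ring⟩
    · have hc : (G.lvl u' : ℝ) + 1 ≤ G.lvl u := by exact_mod_cast hlt
      have ht : t = G.lvl u := by linarith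
      have e : G.lvl u = G.lvl v' := by
        have : (G.lvl u : ℝ) ≤ G.lvl u' + 1 := by linarith
        have : G.lvl u ≤ G.lvl u' + 1 := by exact_mod_cast this
        omega
      have ht2 : t - G.lvl u' = 1 := by rw [ht, e, hl']; push_cast; ring
      have hk : M.key u = M.key v' := by
        rw [ht2, ht] at heq
        have : (M.key u : ℝ) = M.key v' := by linarith
        exact_mod_cast this
      exact ⟨u, .inl rfl, .inr (M.key_inj hB e hk), ht, by rw [ht]; ring⟩
  no_through u v w h hu hv h1 h2 heq := by
    have hl := M.lvl_edge h
    rcases (by omega : G.lvl w = G.lvl u ∨ G.lvl w = G.lvl u + 1) with e | e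
    · rw [e] at heq
      have : (M.key w : ℝ) = M.key u := by linarith
      exact hu (M.key_inj hB e (by exact_mod_cast this))
    · rw [e] at heq
      push_cast at heq
      have : (M.key w : ℝ) = M.key v := by linarith
      exact hv (M.key_inj hB (by omega) (by exact_mod_cast this))
  prec_ok i u v h := by
    obtain ⟨-, rfl, rfl⟩ := (M.prec_iff i u v).1 h
    rw [M.key_w4 (Nat.zero_le _), M.key_w4 le_rfl]
    have : 1 ≤ m * B := Nat.mul_pos hm hB
    exact_mod_cast (by omega : 3 * (0 * B) + 1 < 3 * (m * B) + 1)

end MountainChainSeq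

theorem CLPDrawing.mono_edge {G : ConstrainedLevelGraph V} (D : CLPDrawing G) {u v u' v' : V}
    (h : G.Edge u v) (h' : G.Edge u' v') (hu : G.lvl u = G.lvl u') (hv : G.lvl v = G.lvl v')
    (hx : D.x u < D.x u') : D.x v ≤ D.x v' := by
  by_contra! hc
  have hlt := G.edge_lt u v h
  have hle : (G.lvl u : ℝ) ≤ G.lvl v := by exact_mod_cast hlt.le
  have hcont : ContinuousOn (fun t => D.f u v t - D.f u' v' t)
      (Set.Icc (G.lvl u : ℝ) (G.lvl v : ℝ)) :=
    (D.f_cont u v h).sub (by rw [hu, hv]; exact D.f_cont u' v' h')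
  have h0 : (0 : ℝ) ∈ Set.Icc (D.f u v (G.lvl u) - D.f u' v' (G.lvl u))
      (D.f u v (G.lvl v) - D.f u' v' (G.lvl v)) := by
    rw [D.f_src u v h, D.f_tgt u v h, hu, hv, D.f_src u' v' h', D.f_tgt u' v' h']
    constructor <;> linarith
  obtain ⟨t, ht, he⟩ := intermediate_value_Icc hle hcont h0
  obtain ⟨w, hw, hw', -, -⟩ := D.planar u v u' v' h h'
    (fun e => by rw [(Prod.mk.inj e).1] at hx; exact lt_irrefl _ hx) t ht
    (by rwa [hu, hv] at ht) (sub_eq_zero.1 he)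
  rcases hw with rfl | rfl <;> rcases hw' with rfl | rfl
  · exact lt_irrefl _ hx
  · omega
  · omega
  · exact lt_irrefl _ hc

theorem CLPDrawing.strictMono_edge {G : ConstrainedLevelGraph V} (D : CLPDrawing G)
    {u v u' v' : V} (h : G.Edge u v) (h' : G.Edge u' v') (hu : G.lvl u = G.lvl u')
    (hv : G.lvl v = G.lvl v') (hne : v ≠ v') (hx : D.x u < D.x u') : D.x v < D.x v' :=
  lt_of_le_of_ne (D.mono_edge h h' hu hv hx) fun e => hne (D.x_inj _ _ hv e)

theorem CLPDrawing.lt_of_edge_lt {G : ConstrainedLevelGraph V} (D : CLPDrawing G)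
    {u v u' v' : V} (h : G.Edge u v) (h' : G.Edge u' v') (hu : G.lvl u = G.lvl u')
    (hv : G.lvl v = G.lvl v') (hne : u ≠ u') (hx : D.x v < D.x v') : D.x u < D.x u' := by
  by_contra! hc
  have hlt : D.x u' < D.x u := lt_of_le_of_ne hc fun e => hne (D.x_inj _ _ hu e.symm)
  exact absurd (D.mono_edge h' h hu.symm hv.symm hlt) (not_le.2 hx)

/-- An injective sequence none of whose terms lies strictly between two consecutive ones is
increasing as soon as its last term exceeds its first one. -/
theorem lt_succ_of_no_between {y : ℕ → ℝ} {N : ℕ}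
    (hinj : ∀ i j, i ≤ N → j ≤ N → y i = y j → i = j)
    (hbtw : ∀ i k, i < N → k ≤ N → ¬ (y i < y k ∧ y k < y (i + 1)) ∧
      ¬ (y (i + 1) < y k ∧ y k < y i))
    (h0 : y 0 < y N) : ∀ i < N, y i < y (i + 1) := by
  have hne : ∀ i j, i ≤ N → j ≤ N → i ≠ j → y i < y j ∨ y j < y i := fun i j hi hj h =>
    lt_or_gt_of_ne fun e => h (hinj i j hi hj e)
  have hstep : ∀ i, i + 1 < N → (y i < y (i + 1) ↔ y (i + 1) < y (i + 2)) := by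
    intro i hi
    have h1 := hbtw i (i + 2) (by omega) (by omega)
    have h2 := hbtw (i + 1) i (by omega) (by omega)
    have h3 := hne i (i + 1) (by omega) (by omega) (by omega)
    have h4 := hne (i + 1) (i + 2) (by omega) (by omega) (by omega)
    have h5 := hne i (i + 2) (by omega) (by omega) (by omega)
    grind
  have hall : ∀ i < N, (y i < y (i + 1) ↔ y 0 < y 1) := by
    intro i
    induction i with
    | zero => intro _; rfl
    | succ i ih => intro hi; rw [← ih (by omega)]; exact (hstep i hi).symm
  by_cases h : y 0 < y 1
  · exact fun i hi => (hall i hi).2 h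
  · exfalso
    have hdec : ∀ i ≤ N, y i ≤ y 0 := by
      intro i
      induction i with
      | zero => intro _; rfl
      | succ i ih =>
        intro hi
        have := (hall i hi).not.2 h
        have := ih (by omega)
        linarith
    exact absurd (hdec N le_rfl) (not_le.2 h0)

namespace MountainChainSeq

variable {G : ConstrainedLevelGraph V} {m B : ℕ} (M : MountainChainSeq G m B)

theorem exists_edge_of_lvl_two (M : MountainChainSeq G m B) {v : V} (hv : G.lvl v = 2) :
    ∃ w, G.Edge v w ∧ G.lvl w = 3 := by
  rcases M.cover v with ⟨i, hi, rfl⟩ | ⟨i, hi, rfl⟩ | ⟨i, hi, rfl⟩ | ⟨i, hi, rfl⟩ |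
    ⟨i, hi, rfl⟩ | ⟨i, hi, rfl⟩ | ⟨i, hi, rfl⟩
  · rw [M.lvl_g i hi] at hv; omega
  · exact ⟨_, M.edge_a_p hi, M.lvl_p i hi⟩
  · rw [M.lvl_p i hi] at hv; omega
  · exact ⟨_, M.edge_d_p hi, M.lvl_p i hi⟩
  · exact ⟨_, M.edge_w2_w3 hi, M.lvl_w3 i hi⟩
  · rw [M.lvl_w3 i hi] at hv; omega
  · rw [M.lvl_w4 i hi] at hv; omega

theorem eq_or_eq_of_edge_p {v : V} {i : ℕ} (hi : i < m * B) (h : G.Edge v (M.p i)) :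
    v = M.a i ∨ v = M.d i := by
  have hlv := M.lvl_edge h
  have hlp := M.lvl_p i hi
  rcases (M.edge_iff _ _).1 h with
    ⟨k, hk, ⟨rfl, e⟩ | ⟨rfl, e⟩ | ⟨rfl, e⟩ | ⟨rfl, e⟩⟩ |
    ⟨j, hj, ⟨rfl, e⟩ | ⟨rfl, e⟩ | ⟨rfl, e⟩⟩
  · rw [e, M.lvl_a k hk] at hlp; omega
  · rw [M.p_inj i k hi hk e]; exact .inl rfl
  · rw [M.p_inj i k hi hk e]; exact .inr rfl
  · rw [e, M.lvl_d k hk] at hlp; omega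
  · rw [e, M.lvl_w2 j hj] at hlp; omega
  · exact absurd e (M.pw_ne i j hi hj)
  · rw [e, M.lvl_w4 j hj] at hlp; omega

variable (D : CLPDrawing G)

/-- The two level-2 vertices of a mountain are consecutive on their level. -/
theorem no_between_a_d {i : ℕ} (hi : i < m * B) {v : V} (hv : G.lvl v = 2) :
    ¬ (D.x (M.a i) < D.x v ∧ D.x v < D.x (M.d i)) ∧
      ¬ (D.x (M.d i) < D.x v ∧ D.x v < D.x (M.a i)) := by
  obtain ⟨w, hw, hlw⟩ := M.exists_edge_of_lvl_two hv
  have la := M.lvl_a i hi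
  have ld := M.lvl_d i hi
  have lp := M.lvl_p i hi
  have key : D.x w = D.x (M.p i) → v = M.a i ∨ v = M.d i := by
    intro e
    rw [D.x_inj w _ (by omega) e] at hw
    exact M.eq_or_eq_of_edge_p hi hw
  constructor <;> rintro ⟨h1, h2⟩
  · rcases key (le_antisymm (D.mono_edge hw (M.edge_d_p hi) (by omega) (by omega) h2)
      (D.mono_edge (M.edge_a_p hi) hw (by omega) (by omega) h1)) with rfl | rfl
    exacts [lt_irrefl _ h1, lt_irrefl _ h2]
  · rcases key (le_antisymm (D.mono_edge hw (M.edge_a_p hi) (by omega) (by omega) h2)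
      (D.mono_edge (M.edge_d_p hi) hw (by omega) (by omega) h1)) with rfl | rfl
    exacts [lt_irrefl _ h2, lt_irrefl _ h1]

/-- The two ground vertices of a mountain are consecutive on their level. -/
theorem no_between_g {i k : ℕ} (hi : i < m * B) (hk : k ≤ m * B) :
    ¬ (D.x (M.g i) < D.x (M.g k) ∧ D.x (M.g k) < D.x (M.g (i + 1))) ∧
      ¬ (D.x (M.g (i + 1)) < D.x (M.g k) ∧ D.x (M.g k) < D.x (M.g i)) := by
  by_cases h1 : k = i
  · subst h1; simp
  by_cases h2 : k = i + 1
  · subst h2; simp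
  obtain ⟨q, hq, hqa, hqd⟩ : ∃ q, G.Edge (M.g k) q ∧ q ≠ M.a i ∧ q ≠ M.d i := by
    rcases Nat.lt_or_ge k (m * B) with hk' | hk'
    · exact ⟨_, M.edge_g_a hk', fun e => h1 (M.a_inj _ _ hk' hi e), M.ad_ne _ _ hk' hi⟩
    · obtain ⟨l, rfl⟩ : ∃ l, k = l + 1 := ⟨k - 1, by omega⟩
      exact ⟨_, M.edge_g_d (by omega), (M.ad_ne _ _ hi (by omega)).symm,
        fun e => h2 (by rw [M.d_inj _ _ (by omega) hi e])⟩
  have lk := M.lvl_g k hk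
  have l0 := M.lvl_g i hi.le
  have l1 := M.lvl_g (i + 1) hi
  have la := M.lvl_a i hi
  have ld := M.lvl_d i hi
  have lq := M.lvl_edge hq
  have hb := M.no_between_a_d D hi (v := q) (by omega)
  constructor <;> rintro ⟨h1, h2⟩
  · exact hb.1 ⟨D.strictMono_edge (M.edge_g_a hi) hq (by omega) (by omega) hqa.symm h1,
      D.strictMono_edge hq (M.edge_g_d hi) (by omega) (by omega) hqd h2⟩
  · exact hb.2 ⟨D.strictMono_edge (M.edge_g_d hi) hq (by omega) (by omega) hqd.symm h1,
      D.strictMono_edge hq (M.edge_g_a hi) (by omega) (by omega) hqa h2⟩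

theorem x_g_zero_lt (hm : 1 ≤ m) (hB : 1 ≤ B) : D.x (M.g 0) < D.x (M.g (m * B)) := by
  have hpos : 1 ≤ m * B := Nat.mul_pos hm hB
  have h4 : D.x (M.w4 0) < D.x (M.w4 m) := D.prec_ok 4 _ _ ((M.prec_iff _ _ _).2 ⟨rfl, rfl, rfl⟩)
  have h0 : 0 ≤ m := Nat.zero_le m
  have h3 : D.x (M.w3 0) < D.x (M.w3 m) :=
    D.lt_of_edge_lt (M.edge_w3_w4 h0) (M.edge_w3_w4 le_rfl)
      (by rw [M.lvl_w3 0 h0, M.lvl_w3 m le_rfl]) (by rw [M.lvl_w4 0 h0, M.lvl_w4 m le_rfl])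
      (fun e => by have := M.w3_inj _ _ h0 le_rfl e; omega) h4
  have h2 : D.x (M.w2 0) < D.x (M.w2 m) :=
    D.lt_of_edge_lt (M.edge_w2_w3 h0) (M.edge_w2_w3 le_rfl)
      (by rw [M.lvl_w2 0 h0, M.lvl_w2 m le_rfl]) (by rw [M.lvl_w3 0 h0, M.lvl_w3 m le_rfl])
      (fun e => by have := M.w2_inj _ _ h0 le_rfl e; omega) h3
  have he := M.edge_g_w2 h0
  rw [Nat.zero_mul] at he
  exact D.lt_of_edge_lt he (M.edge_g_w2 le_rfl)
    (by rw [M.lvl_g 0 (Nat.zero_le _), M.lvl_g _ le_rfl])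
    (by rw [M.lvl_w2 0 h0, M.lvl_w2 m le_rfl])
    (fun e => by have := M.g_inj _ _ (Nat.zero_le _) le_rfl e; omega) h2

theorem x_g_lt (hm : 1 ≤ m) (hB : 1 ≤ B) {i k : ℕ} (hik : i < k) (hk : k ≤ m * B) :
    D.x (M.g i) < D.x (M.g k) := by
  have hstep := lt_succ_of_no_between (y := fun i => D.x (M.g i)) (N := m * B)
    (fun i j hi hj e => M.g_inj i j hi hj
      (D.x_inj _ _ (by rw [M.lvl_g i hi, M.lvl_g j hj]) e))
    (fun i k hi hk => M.no_between_g D hi hk) (M.x_g_zero_lt D hm hB)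
  induction k, hik using Nat.le_induction with
  | base => exact hstep i hk
  | succ k _ ih => exact (ih (by omega)).trans (hstep k hk)

/-- Every level-2 vertex is joined to a ground vertex which determines its key up to `1`. -/
theorem exists_ground {v : V} (hv : G.lvl v = 2) : ∃ k ≤ m * B, G.Edge (M.g k) v ∧
    ((M.key v = 3 * k ∧ ∃ i < m * B, k = i + 1 ∧ v = M.d i) ∨ M.key v = 3 * k + 1 ∨
      (M.key v = 3 * k + 2 ∧ k < m * B ∧ v = M.a k)) := by
  rcases M.cover v with ⟨i, hi, rfl⟩ | ⟨i, hi, rfl⟩ | ⟨i, hi, rfl⟩ | ⟨i, hi, rfl⟩ |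
    ⟨i, hi, rfl⟩ | ⟨i, hi, rfl⟩ | ⟨i, hi, rfl⟩
  · rw [M.lvl_g i hi] at hv; omega
  · exact ⟨i, hi.le, M.edge_g_a hi, .inr (.inr ⟨M.key_a hi, hi, rfl⟩)⟩
  · rw [M.lvl_p i hi] at hv; omega
  · exact ⟨i + 1, hi, M.edge_g_d hi, .inl ⟨M.key_d hi, i, hi, rfl, rfl⟩⟩
  · exact ⟨i * B, Nat.mul_le_mul_right B hi, M.edge_g_w2 hi, .inr (.inl (M.key_w2 hi))⟩
  · rw [M.lvl_w3 i hi] at hv; omega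
  · rw [M.lvl_w4 i hi] at hv; omega

theorem x_lt_of_ground_lt (hm : 1 ≤ m) (hB : 1 ≤ B) {u v : V} {i k : ℕ} (hik : i < k)
    (hk : k ≤ m * B) (hu : G.Edge (M.g i) u) (hv : G.Edge (M.g k) v) (hne : u ≠ v) :
    D.x u < D.x v := by
  have li := M.lvl_g i (hik.le.trans hk)
  have lk := M.lvl_g k hk
  have lu := M.lvl_edge hu
  have lv := M.lvl_edge hv
  exact D.strictMono_edge hu hv (by omega) (by omega) hne (M.x_g_lt D hm hB hik hk)

theorem x_lt_of_lvl_two (hm : 1 ≤ m) (hB : 1 ≤ B) {u v : V} (hu : G.lvl u = 2)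
    (hv : G.lvl v = 2) (h : M.key u < M.key v) : D.x u < D.x v := by
  obtain ⟨i, hi, hui, cu⟩ := M.exists_ground hu
  obtain ⟨k, hk, hvk, cv⟩ := M.exists_ground hv
  have hne : u ≠ v := fun e => by rw [e] at h; exact lt_irrefl _ h
  rcases (by omega : i < k ∨ i = k) with hik | rfl
  · exact M.x_lt_of_ground_lt D hm hB hik hk hui hvk hne
  have hxne : D.x u ≠ D.x v := fun e => hne (D.x_inj _ _ (by omega) e)
  by_contra! hc
  have hlt : D.x v < D.x u := lt_of_le_of_ne hc hxne.symm
  rcases (by omega : M.key u = 3 * i ∨ M.key v = 3 * i + 2) with e | e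
  · obtain ⟨-, l, hl, rfl, rfl⟩ : M.key u = 3 * i ∧ ∃ l < m * B, i = l + 1 ∧ u = M.d l := by
      rcases cu with c | c | c
      exacts [c, by omega, by omega]
    have hav : M.a l ≠ v := fun e' => by rw [← e', M.key_a hl] at h; rw [M.key_d hl] at h; omega
    exact (M.no_between_a_d D hl hv).1
      ⟨M.x_lt_of_ground_lt D hm hB (Nat.lt_succ_self l) hk (M.edge_g_a hl) hvk hav, hlt⟩
  · obtain ⟨-, hl, rfl⟩ : M.key v = 3 * i + 2 ∧ i < m * B ∧ v = M.a i := by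
      rcases cv with c | c | c
      exacts [by omega, by omega, c]
    have hdu : u ≠ M.d i := fun e' => by rw [e', M.key_d hl] at h; omega
    exact (M.no_between_a_d D hl hu).1
      ⟨hlt, M.x_lt_of_ground_lt D hm hB (Nat.lt_succ_self i) hl hui (M.edge_g_d hl) hdu⟩

theorem exists_edge_key_eq {v : V} (hv : 3 ≤ G.lvl v) :
    ∃ u, G.Edge u v ∧ M.key u = M.key v := by
  rcases M.cover v with ⟨i, hi, rfl⟩ | ⟨i, hi, rfl⟩ | ⟨i, hi, rfl⟩ | ⟨i, hi, rfl⟩ |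
    ⟨i, hi, rfl⟩ | ⟨i, hi, rfl⟩ | ⟨i, hi, rfl⟩
  · rw [M.lvl_g i hi] at hv; omega
  · rw [M.lvl_a i hi] at hv; omega
  · exact ⟨_, M.edge_a_p hi, by rw [M.key_a hi, M.key_p hi]⟩
  · rw [M.lvl_d i hi] at hv; omega
  · rw [M.lvl_w2 i hi] at hv; omega
  · exact ⟨_, M.edge_w2_w3 hi, by rw [M.key_w2 hi, M.key_w3 hi]⟩
  · exact ⟨_, M.edge_w3_w4 hi, by rw [M.key_w3 hi, M.key_w4 hi]⟩

theorem exists_eq_g {v : V} (hv : G.lvl v = 1) : ∃ i ≤ m * B, v = M.g i := by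
  rcases M.cover v with h | ⟨i, hi, rfl⟩ | ⟨i, hi, rfl⟩ | ⟨i, hi, rfl⟩ |
    ⟨i, hi, rfl⟩ | ⟨i, hi, rfl⟩ | ⟨i, hi, rfl⟩
  · exact h
  · rw [M.lvl_a i hi] at hv; omega
  · rw [M.lvl_p i hi] at hv; omega
  · rw [M.lvl_d i hi] at hv; omega
  · rw [M.lvl_w2 i hi] at hv; omega
  · rw [M.lvl_w3 i hi] at hv; omega
  · rw [M.lvl_w4 i hi] at hv; omega

/-- In every drawing, the vertices of a level are ordered by their keys. -/
theorem x_lt_of_key_lt (hm : 1 ≤ m) (hB : 1 ≤ B) (n : ℕ) :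
    ∀ {u v : V}, G.lvl u = n → G.lvl v = n → M.key u < M.key v → D.x u < D.x v := by
  induction n with
  | zero => intro u v hu; have := G.lvl_one_le u; omega
  | succ n ih =>
    intro u v hu hv h
    rcases (by omega : n = 0 ∨ n = 1 ∨ 2 ≤ n) with rfl | rfl | hn
    · obtain ⟨i, hi, rfl⟩ := M.exists_eq_g hu
      obtain ⟨k, hk, rfl⟩ := M.exists_eq_g hv
      rw [M.key_g hi, M.key_g hk] at h
      exact M.x_g_lt D hm hB (by omega) hk
    · exact M.x_lt_of_lvl_two D hm hB hu hv h
    · obtain ⟨u', eu, ku⟩ := M.exists_edge_key_eq (v := u) (by omega)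
      obtain ⟨v', ev, kv⟩ := M.exists_edge_key_eq (v := v) (by omega)
      have lu := M.lvl_edge eu
      have lv := M.lvl_edge ev
      refine D.strictMono_edge eu ev (by omega) (by omega) (fun e => ?_)
        (ih (by omega) (by omega) (by omega))
      rw [e] at h
      exact lt_irrefl _ h

theorem x_lt_iff (hm : 1 ≤ m) (hB : 1 ≤ B) {u v : V} (hl : G.lvl u = G.lvl v) :
    D.x u < D.x v ↔ M.key u < M.key v := by
  refine ⟨fun h => ?_, M.x_lt_of_key_lt D hm hB _ hl rfl⟩
  by_contra! hc
  rcases hc.lt_or_eq with hk | hk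
  · exact lt_asymm h (M.x_lt_of_key_lt D hm hB _ hl.symm rfl hk)
  · rw [M.key_inj hB hl hk.symm] at h
    exact lt_irrefl _ h

end MountainChainSeq

/-- A sequence of `m` mountain `B`-chains (with `m, B ≥ 1`) with
the single constraint `w₀ ≺₄ w_m` admits a constrained level planar drawing,
and this drawing is unique as an embedding: any two constrained level planar
drawings induce the same linear order of the vertices on each level. -/
theorem mountain_chain_unique_drawing (G : ConstrainedLevelGraph V)
    (hh : G.h = 4) (m B : ℕ) (hm : 1 ≤ m) (hB : 1 ≤ B)
    (M : MountainChainSeq G m B) :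
    Nonempty (CLPDrawing G) ∧
      ∀ D1 D2 : CLPDrawing G, ∀ u v : V, G.lvl u = G.lvl v →
        (D1.x u < D1.x v ↔ D2.x u < D2.x v) := by
  exact ⟨⟨M.drawing hm hB⟩, fun D1 D2 u v hl =>
    (M.x_lt_iff D1 hm hB hl).trans (M.x_lt_iff D2 hm hB hl).symm⟩
end

section
/- Let 𝒢 = (G, γ) be a level graph of height 2 and let A and B be two distinct connected components of G, each containing at least one edge. Then in every level planar drawing of 𝒢, either on both levels every vertex of A has smaller x-coordinate than every vertex of B, or on both levels every vertex of B has smaller x-coordinate than every vertex of A (i.e., there is an unbounded y-monotone curve separating A from B). -/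
open scoped Classical

/-- A level graph: a finite directed graph with a surjective level assignment
`lvl : V → {1, …, h}` such that edges go strictly upwards. -/
structure LevelGraph (V : Type) [Fintype V] where
  h : ℕ
  Edge : V → V → Prop
  lvl : V → ℕ
  lvl_one_le : ∀ v, 1 ≤ lvl v
  lvl_le : ∀ v, lvl v ≤ h
  lvl_surj : ∀ i, 1 ≤ i → i ≤ h → ∃ v, lvl v = i
  edge_lt : ∀ u v, Edge u v → lvl u < lvl v

/-- A level planar drawing. -/
structure LevelDrawing {V : Type} [Fintype V] (G : LevelGraph V) where
  x : V → ℝ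
  f : V → V → ℝ → ℝ
  x_inj : ∀ u v, G.lvl u = G.lvl v → x u = x v → u = v
  f_cont : ∀ u v, G.Edge u v → ContinuousOn (f u v) (Set.Icc (G.lvl u : ℝ) (G.lvl v : ℝ))
  f_src : ∀ u v, G.Edge u v → f u v (G.lvl u : ℝ) = x u
  f_tgt : ∀ u v, G.Edge u v → f u v (G.lvl v : ℝ) = x v
  planar : ∀ u v u' v', G.Edge u v → G.Edge u' v' → (u, v) ≠ (u', v') →
    ∀ t : ℝ, t ∈ Set.Icc (G.lvl u : ℝ) (G.lvl v : ℝ) →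
      t ∈ Set.Icc (G.lvl u' : ℝ) (G.lvl v' : ℝ) → f u v t = f u' v' t →
      ∃ w, (w = u ∨ w = v) ∧ (w = u' ∨ w = v') ∧ t = (G.lvl w : ℝ) ∧ f u v t = x w
  no_through : ∀ u v w, G.Edge u v → w ≠ u → w ≠ v →
    G.lvl u ≤ G.lvl w → G.lvl w ≤ G.lvl v → f u v (G.lvl w : ℝ) ≠ x w

variable {V : Type} [Fintype V]

/-- Undirected reachability (being in the same connected component). -/
def Reach (G : LevelGraph V) : V → V → Prop :=
  Relation.ReflTransGen fun u v => G.Edge u v ∨ G.Edge v u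

theorem Reach.symm {G : LevelGraph V} {p q : V} (h : Reach G p q) : Reach G q p :=
  haveI : Std.Symm fun u v => G.Edge u v ∨ G.Edge v u := ⟨fun _ _ => Or.symm⟩
  Relation.ReflTransGen.stdSymm.symm _ _ h

theorem Reach.trans {G : LevelGraph V} {p q r : V} (h : Reach G p q) (h' : Reach G q r) :
    Reach G p r :=
  Relation.ReflTransGen.trans h h'

theorem Reach.of_edge {G : LevelGraph V} {u v : V} (h : G.Edge u v) : Reach G u v :=
  Relation.ReflTransGen.single (Or.inl h)

/-- A vertex whose component contains an edge is itself incident to an edge. -/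
theorem Reach.exists_incident {G : LevelGraph V} {q u v : V} (h : Reach G q u)
    (he : G.Edge u v) : ∃ s t, G.Edge s t ∧ (q = s ∨ q = t) := by
  rcases Relation.ReflTransGen.cases_head h with rfl | ⟨c, hc | hc, -⟩
  · exact ⟨q, v, he, Or.inl rfl⟩
  · exact ⟨q, c, hc, Or.inl rfl⟩
  · exact ⟨c, q, hc, Or.inr rfl⟩

theorem LevelGraph.lvl_of_edge {G : LevelGraph V} (hh : G.h = 2) {u v : V}
    (h : G.Edge u v) : G.lvl u = 1 ∧ G.lvl v = 2 := by
  have h1 := G.lvl_one_le u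
  have h2 := G.lvl_le v
  have h3 := G.edge_lt u v h
  omega

namespace LevelDrawing

variable {G : LevelGraph V} (D : LevelDrawing G)

/-- Vertex-disjoint edges spanning the same levels do not change their order. -/
theorem x_tgt_lt {u v u' v' : V} (he : G.Edge u v) (he' : G.Edge u' v')
    (hs : G.lvl u = G.lvl u') (ht : G.lvl v = G.lvl v') (hu : u ≠ u') (hv : v ≠ v')
    (h : D.x u < D.x u') : D.x v < D.x v' := by
  by_contra! hle
  have hlt := G.edge_lt u v he
  have c' := D.f_cont u' v' he'
  have s' := D.f_src u' v' he'
  have t' := D.f_tgt u' v' he'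
  rw [← hs, ← ht] at c'
  rw [← hs] at s'
  rw [← ht] at t'
  obtain ⟨t, htm, heq⟩ := isPreconnected_Icc.intermediate_value₂
    (Set.left_mem_Icc.2 (by exact_mod_cast hlt.le)) (Set.right_mem_Icc.2 (by exact_mod_cast hlt.le))
    (D.f_cont u v he) c' (by rw [D.f_src u v he, s']; exact h.le)
    (by rw [D.f_tgt u v he, t']; exact hle)
  obtain ⟨w, rfl | rfl, rfl | rfl, -⟩ := D.planar u v u' v' he he'
    (fun h => hu (congrArg Prod.fst h)) t htm (by rw [← hs, ← ht]; exact htm) heq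
  · exact hu rfl
  · omega
  · omega
  · exact hv rfl

theorem x_src_lt_iff {u v u' v' : V} (he : G.Edge u v) (he' : G.Edge u' v')
    (hs : G.lvl u = G.lvl u') (ht : G.lvl v = G.lvl v') (hu : u ≠ u') (hv : v ≠ v') :
    D.x u < D.x u' ↔ D.x v < D.x v' := by
  refine ⟨D.x_tgt_lt he he' hs ht hu hv, fun h => ?_⟩
  by_contra! hle
  exact h.not_gt (D.x_tgt_lt he' he hs.symm ht.symm hu.symm hv.symm
    (hle.lt_of_ne fun h => hu (D.x_inj _ _ hs h.symm)))

/-- In a drawing of height 2, the vertex `p` lies to the left of the endpoint of the edge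
`(u, v)` on its level. -/
def IsLeft (u v p : V) : Prop :=
  D.x p < if G.lvl p = 1 then D.x u else D.x v

theorem isLeft_src_iff (hh : G.h = 2) {u v s t : V} (he : G.Edge s t) :
    D.IsLeft u v s ↔ D.x s < D.x u := by
  simp [IsLeft, (G.lvl_of_edge hh he).1]

theorem isLeft_tgt_iff (hh : G.h = 2) {u v s t : V} (he : G.Edge s t) :
    D.IsLeft u v t ↔ D.x t < D.x v := by
  simp [IsLeft, (G.lvl_of_edge hh he).2]

/-- A component avoiding an edge lies entirely on one side of it. -/
theorem isLeft_iff_of_reach (hh : G.h = 2) {u v a p : V} (he : G.Edge u v)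
    (ha : ¬ Reach G a u) (h : Reach G a p) : D.IsLeft u v a ↔ D.IsLeft u v p := by
  have key : ∀ s t, G.Edge s t → Reach G a s → (D.IsLeft u v s ↔ D.IsLeft u v t) := by
    intro s t hst hs
    obtain ⟨h1, h2⟩ := G.lvl_of_edge hh hst
    obtain ⟨h3, h4⟩ := G.lvl_of_edge hh he
    rw [D.isLeft_src_iff hh hst, D.isLeft_tgt_iff hh hst]
    refine D.x_src_lt_iff hst he (h1.trans h3.symm) (h2.trans h4.symm) ?_ ?_
    · rintro rfl
      exact ha hs
    · rintro rfl
      exact ha ((hs.trans (Reach.of_edge hst)).trans (Reach.of_edge he).symm)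
  induction h with
  | refl => rfl
  | tail hab hbc ih =>
    rcases hbc with hbc | hbc
    · exact ih.trans (key _ _ hbc hab)
    · exact ih.trans (key _ _ hbc (Reach.trans hab (Reach.of_edge hbc).symm)).symm

/-- If some edge of one component is to the left of some edge of another component, then the
whole first component is to the left of the second. -/
theorem x_lt_of_edge_lt (hh : G.h = 2) {a b u v u' v' : V} (hab : ¬ Reach G a b)
    (he : G.Edge u v) (hu : Reach G a u) (he' : G.Edge u' v') (hu' : Reach G b u')
    (hlt : D.x u < D.x u') {p q : V} (hp : Reach G a p) (hq : Reach G b q)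
    (hpq : G.lvl p = G.lvl q) : D.x p < D.x q := by
  obtain ⟨s, t, hst, hqst⟩ := (hq.symm.trans hu').exists_incident he'
  have hs : Reach G b s := by
    rcases hqst with rfl | rfl
    · exact hq
    · exact hq.trans (Reach.of_edge hst).symm
  have hus : D.x u < D.x s := by
    have hns : ¬ D.IsLeft u v s := by
      rw [← D.isLeft_iff_of_reach hh he (fun h => hab (hu.trans h.symm)) hs,
        D.isLeft_iff_of_reach hh he (fun h => hab (hu.trans h.symm)) hu',
        D.isLeft_src_iff hh he']
      exact hlt.not_gt
    rw [D.isLeft_src_iff hh hst, not_lt] at hns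
    refine hns.lt_of_ne fun h => hab ?_
    obtain rfl := D.x_inj u s
      ((G.lvl_of_edge hh he).1.trans (G.lvl_of_edge hh hst).1.symm) h
    exact hu.trans hs.symm
  have has : ¬ Reach G a s := fun h => hab (h.trans hs.symm)
  have hleft : D.IsLeft s t p := (D.isLeft_iff_of_reach hh hst has hp).1
    ((D.isLeft_iff_of_reach hh hst has hu).2 ((D.isLeft_src_iff hh he).2 hus))
  obtain ⟨h1, h2⟩ := G.lvl_of_edge hh hst
  rcases hqst with rfl | rfl
  · simpa [IsLeft, hpq, h1] using hleft
  · simpa [IsLeft, hpq, h2] using hleft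

end LevelDrawing

/-- In a level graph of height 2, two distinct connected
components `A` (the component of `a`) and `B` (the component of `b`), each
containing at least one edge, are separated in every level planar drawing:
on every level either all of `A` precedes all of `B`, or vice versa. -/
theorem components_separated_two_levels (G : LevelGraph V) (hh : G.h = 2)
    (a b : V) (hab : ¬ Reach G a b)
    (hA : ∃ u v, G.Edge u v ∧ Reach G a u)
    (hB : ∃ u v, G.Edge u v ∧ Reach G b u)
    (D : LevelDrawing G) :
    (∀ p q, Reach G a p → Reach G b q → G.lvl p = G.lvl q → D.x p < D.x q) ∨
    (∀ p q, Reach G b p → Reach G a q → G.lvl p = G.lvl q → D.x p < D.x q) := by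
  obtain ⟨u, v, he, hu⟩ := hA
  obtain ⟨u', v', he', hu'⟩ := hB
  rcases lt_trichotomy (D.x u) (D.x u') with h | h | h
  · exact Or.inl fun p q hp hq => D.x_lt_of_edge_lt hh hab he hu he' hu' h hp hq
  · obtain rfl := D.x_inj u u'
      ((G.lvl_of_edge hh he).1.trans (G.lvl_of_edge hh he').1.symm) h
    exact absurd (hu.trans hu'.symm) hab
  · exact Or.inr fun p q hp hq =>
      D.x_lt_of_edge_lt hh (fun h => hab h.symm) he' hu' he hu h hp hq
end

section
/- Let 𝒢 = (G, γ) be a level graph of height 2 whose underlying undirected graph is a connected caterpillar with at least 3 vertices, and let (v_1, …, v_k), k ≥ 2, be its spine, i.e., the path induced by the vertices of degree at least 2. Then a pair (<_1, <_2) of linear orders on the two levels arises as the left-to-right vertex order (by x-coordinates) of some level planar drawing of 𝒢 if and only if, after possibly replacing the spine enumeration (v_1, …, v_k) by its reverse, all of the following hold: (a) for any two spine vertices v_i, v_j on the same level, v_i precedes v_j in the order of that level if and only if i < j; (b) for every i with 2 ≤ i ≤ k−1 and every non-spine neighbor u of v_i, u lies strictly between v_{i−1} and v_{i+1} in the order of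 u's level; (c) every non-spine neighbor u of v_1 precedes v_2 in the order of u's level; (d) v_{k−1} precedes every non-spine neighbor u of v_k in the order of u's level. -/
open scoped Classical

variable {V : Type} [Fintype V]

/-- Undirected adjacency. -/
def Adj (G : LevelGraph V) (u v : V) : Prop :=
  G.Edge u v ∨ G.Edge v u

/-- The degree of a vertex (number of vertices adjacent to it). -/
noncomputable def deg (G : LevelGraph V) (v : V) : ℕ :=
  Nat.card {u : V // Adj G v u}

/-- A caterpillar: a tree in which every vertex is within distance at most one
of a central path. -/
def IsCaterpillar {α : Type} (H : SimpleGraph α) : Prop :=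
  H.Connected ∧ H.IsAcyclic ∧
    ∃ p : List α, p ≠ [] ∧ p.Chain' H.Adj ∧ p.Nodup ∧
      ∀ v : α, v ∈ p ∨ ∃ w ∈ p, H.Adj v w

/-- A strict order `lt` on the vertices of a bipartite graph with sides `lvl = 1` and `lvl = 2`,
which compares exactly the pairs of vertices on a common side. -/
structure IsTwoLevelOrder {α : Type*} (lvl : α → ℕ) (adj lt : α → α → Prop) : Prop where
  symm : ∀ u v, adj u v → adj v u
  lvl_ne : ∀ u v, adj u v → lvl u ≠ lvl v
  two : ∀ v, lvl v = 1 ∨ lvl v = 2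
  irrefl : ∀ v, ¬ lt v v
  trans : ∀ u v w, lt u v → lt v w → lt u w
  lvl_eq : ∀ u v, lt u v → lvl u = lvl v
  total : ∀ u v, lvl u = lvl v → u ≠ v → lt u v ∨ lt v u

/-- No two edges cross. -/
def NonCrossing {α : Type*} (adj lt : α → α → Prop) : Prop :=
  ∀ a b a' b', adj a b → adj a' b' → lt a a' → ¬ lt b' b

/-- The conditions on the order along a spine `e 0, …, e (k - 1)`. -/
def SpineOrdered {α : Type*} (lvl : α → ℕ) (adj lt : α → α → Prop) (k : ℕ) (leaf : α → Prop)
    (e : ℕ → α) : Prop :=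
  (∀ i j, i < k → j < k → lvl (e i) = lvl (e j) → (i < j ↔ lt (e i) (e j))) ∧
  (∀ i, 1 ≤ i → i + 1 < k → ∀ u, adj (e i) u → leaf u →
    lt (e (i - 1)) u ∧ lt u (e (i + 1))) ∧
  (∀ u, adj (e 0) u → leaf u → lt u (e 1)) ∧
  (∀ u, adj (e (k - 1)) u → leaf u → lt (e (k - 2)) u)

namespace IsTwoLevelOrder

variable {α : Type*} {lvl : α → ℕ} {adj lt : α → α → Prop}

theorem lvl_eq_of_adj (h : IsTwoLevelOrder lvl adj lt) {a b c d : α} (hab : adj a b)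
    (hcd : adj c d) (hac : lvl a = lvl c) : lvl b = lvl d := by
  have := h.lvl_ne _ _ hab
  have := h.lvl_ne _ _ hcd
  have := h.two a
  have := h.two b
  have := h.two c
  have := h.two d
  omega

theorem flip (h : IsTwoLevelOrder lvl adj lt) : IsTwoLevelOrder lvl adj (flip lt) where
  symm := h.symm
  lvl_ne := h.lvl_ne
  two := h.two
  irrefl := h.irrefl
  trans _ _ _ huv hvw := h.trans _ _ _ hvw huv
  lvl_eq _ _ huv := (h.lvl_eq _ _ huv).symm
  total u v huv hne := (h.total u v huv hne).symm

/-- Along a path that never turns back, a non-crossing order zigzags in one direction. -/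
theorem lt_add_two (h : IsTwoLevelOrder lvl adj lt) (hnc : NonCrossing adj lt) {n : ℕ}
    {s : ℕ → α} (hadj : ∀ i, i < n → adj (s i) (s (i + 1)))
    (hne : ∀ i, i + 1 < n → s i ≠ s (i + 2)) (h0 : lt (s 0) (s 2)) :
    ∀ i, i + 1 < n → lt (s i) (s (i + 2)) := by
  intro i
  induction i with
  | zero => exact fun _ => h0
  | succ i ih =>
    intro hi
    have h1 := ih (by omega)
    have h2 := hadj i (by omega)
    have h3 := hadj (i + 2) (by omega)
    exact (h.total _ _ (h.lvl_eq_of_adj h2 h3 (h.lvl_eq _ _ h1)) (hne _ hi)).resolve_right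
      (hnc _ _ _ _ h2 h3 h1)

theorem eq_or_lt_of_le (h : IsTwoLevelOrder lvl adj lt) {n : ℕ} {s : ℕ → α}
    (hadj : ∀ i, i + 1 < n → adj (s i) (s (i + 1)))
    (hlt : ∀ i, i + 2 < n → lt (s i) (s (i + 2))) (d i : ℕ) (hi : i + d < n)
    (hl : lvl (s i) = lvl (s (i + d))) : d = 0 ∨ lt (s i) (s (i + d)) := by
  induction d using Nat.strong_induction_on generalizing i with
  | _ d ih =>
    match d, ih, hi, hl with
    | 0, _, _, _ => exact Or.inl rfl
    | 1, _, hi, hl => exact absurd hl (h.lvl_ne _ _ (hadj i hi))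
    | d + 2, ih, hi, hl =>
      right
      have h1 := hlt i (by omega)
      have e1 : i + 2 + d = i + (d + 2) := by omega
      rcases ih d (by omega) (i + 2) (by omega)
        (by rw [e1, ← hl]; exact (h.lvl_eq _ _ h1).symm) with h2 | h2
      · subst h2; exact h1
      · rw [e1] at h2; exact h.trans _ _ _ h1 h2

theorem spineOrdered_of_lt (h : IsTwoLevelOrder lvl adj lt) (hnc : NonCrossing adj lt) {k : ℕ}
    (hk : 2 ≤ k) {s : ℕ → α} {leaf : α → Prop}
    (hadj : ∀ i, i < k + 1 → adj (s i) (s (i + 1)))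
    (hne : ∀ i, i < k → s i ≠ s (i + 2)) (h0 : lt (s 0) (s 2))
    (hleaf : ∀ u, leaf u → ∀ i, i < k → u ≠ s (i + 1)) :
    SpineOrdered lvl adj lt k leaf (fun i => s (i + 1)) := by
  have hlt : ∀ i, i < k → lt (s i) (s (i + 2)) := fun i hi =>
    h.lt_add_two hnc hadj (fun i hi => hne i (by omega)) h0 i (by omega)
  have hmono : ∀ i j, i < j → j < k → lvl (s (i + 1)) = lvl (s (j + 1)) →
      lt (s (i + 1)) (s (j + 1)) := by
    intro i j hij hj hl
    obtain ⟨d, rfl⟩ := Nat.exists_eq_add_of_lt hij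
    rcases h.eq_or_lt_of_le (n := k) (s := fun i => s (i + 1))
      (fun i hi => hadj (i + 1) (by omega)) (fun i hi => hlt (i + 1) (by omega))
      (d + 1) i (by omega) hl with h' | h'
    · omega
    · exact h'
  have hright : ∀ i, i + 1 < k → ∀ u, adj (s (i + 1)) u → leaf u → lt u (s (i + 2)) := by
    intro i hi u hu hl
    have h1 := hlt (i + 1) (by omega)
    have h2 := hadj (i + 2) (by omega)
    have h3 := h.symm _ _ h2
    exact (h.total _ _ (h.lvl_eq_of_adj hu h3 (h.lvl_eq _ _ h1)) (hleaf u hl _ hi)).resolve_right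
      (hnc _ _ _ _ hu h3 h1)
  have hleft : ∀ i, i + 1 < k → ∀ u, adj (s (i + 2)) u → leaf u → lt (s (i + 1)) u := by
    intro i hi u hu hl
    have h1 := hlt i (by omega)
    have h2 := hadj i (by omega)
    exact (h.total _ _ (h.lvl_eq_of_adj h2 hu (h.lvl_eq _ _ h1))
      (hleaf u hl i (by omega)).symm).resolve_right (hnc _ _ _ _ h2 hu h1)
  refine ⟨fun i j hi hj hl => ⟨fun hij => hmono i j hij hj hl, fun hij => ?_⟩,
    fun i h1 hi u hu hl => ?_, fun u hu hl => hright 0 (by omega) u hu hl, fun u hu hl => ?_⟩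
  · by_contra hcon
    rcases Nat.lt_or_eq_of_le (not_lt.1 hcon) with hji | rfl
    · exact h.irrefl _ (h.trans _ _ _ hij (hmono j i hji hi hl.symm))
    · exact h.irrefl _ hij
  · obtain ⟨i, rfl⟩ := Nat.exists_eq_add_of_le' h1
    exact ⟨hleft i (by omega) u hu hl, hright (i + 1) hi u hu hl⟩
  · obtain ⟨m, rfl⟩ := Nat.exists_eq_add_of_le' hk
    exact hleft m (by omega) u hu hl

/-- A non-crossing order is ordered along the spine in one of the two directions. -/
theorem exists_spineOrdered (h : IsTwoLevelOrder lvl adj lt) (hnc : NonCrossing adj lt) {k : ℕ}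
    (hk : 2 ≤ k) {sp : ℕ → α} {leaf : α → Prop}
    (hinj : ∀ i j, i < k → j < k → sp i = sp j → i = j)
    (hpath : ∀ i, i + 1 < k → adj (sp i) (sp (i + 1)))
    (hleaf : ∀ u, leaf u → ∀ i, i < k → u ≠ sp i)
    (hfst : ∃ w, adj (sp 0) w ∧ w ≠ sp 1)
    (hlst : ∃ w, adj (sp (k - 1)) w ∧ w ≠ sp (k - 2)) :
    ∃ e : ℕ → α, ((∀ i, i < k → e i = sp i) ∨ (∀ i, i < k → e i = sp (k - 1 - i))) ∧
      SpineOrdered lvl adj lt k leaf e := by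
  obtain ⟨w, hw, hw1⟩ := hfst
  obtain ⟨z, hz, hz1⟩ := hlst
  obtain ⟨s, hs0, hs, hsk⟩ : ∃ s : ℕ → α, s 0 = w ∧ (∀ i, i < k → s (i + 1) = sp i) ∧
      s (k + 1) = z := by
    refine ⟨fun i => if i = 0 then w else if i = k + 1 then z else sp (i - 1), by simp, ?_,
      by simp⟩
    intro i hi
    simp [hi.ne]
  have hadj : ∀ i, i < k + 1 → adj (s i) (s (i + 1)) := by
    intro i hi
    rcases Nat.eq_zero_or_pos i with rfl | hi0
    · rw [hs0, hs 0 (by omega)]; exact h.symm _ _ hw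
    obtain ⟨i, rfl⟩ := Nat.exists_eq_add_of_le' hi0
    rw [hs i (by omega)]
    rcases Nat.lt_or_ge (i + 1) k with hik | hik
    · rw [hs _ hik]; exact hpath i hik
    · obtain rfl : k = i + 1 := by omega
      rw [hsk]; exact hz
  have hne : ∀ i, i < k → s i ≠ s (i + 2) := by
    intro i hi
    rcases Nat.eq_zero_or_pos i with rfl | hi0
    · rw [hs0, hs 1 (by omega)]; exact hw1
    obtain ⟨i, rfl⟩ := Nat.exists_eq_add_of_le' hi0
    rw [hs i (by omega)]
    rcases Nat.lt_or_ge (i + 2) k with hik | hik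
    · rw [hs _ hik]; intro hc; have := hinj _ _ (by omega) hik hc; omega
    · obtain rfl : k = i + 2 := by omega
      rw [hsk]; exact hz1.symm
  have hl : lvl (s 0) = lvl (s 2) :=
    h.lvl_eq_of_adj (h.symm _ _ (hadj 0 (by omega))) (hadj 1 (by omega)) rfl
  rcases h.total _ _ hl (hne 0 (by omega)) with h0 | h0
  · refine ⟨fun i => s (i + 1), Or.inl hs, h.spineOrdered_of_lt hnc hk hadj hne h0 ?_⟩
    intro u hu i hi
    rw [hs i hi]
    exact hleaf u hu i hi
  · have hlt := h.flip.lt_add_two (fun a b a' b' hab hab' h1 h2 => hnc _ _ _ _ hab' hab h1 h2)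
      hadj (fun i hi => hne i (by omega)) h0
    have hrev : ∀ i, i < k → s (k + 1 - (i + 1)) = sp (k - 1 - i) := by
      intro i hi
      rw [← hs (k - 1 - i) (by omega)]
      congr 1
      omega
    refine ⟨fun i => s (k + 1 - (i + 1)), Or.inr hrev,
      h.spineOrdered_of_lt (s := fun i => s (k + 1 - i)) hnc hk ?_ ?_ ?_ ?_⟩
    · intro i hi
      have := h.symm _ _ (hadj (k - i) (by omega))
      rwa [show k - i + 1 = k + 1 - i by omega, show k - i = k + 1 - (i + 1) by omega] at this
    · intro i hi
      have := (hne (k - 1 - i) (by omega)).symm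
      rwa [show k - 1 - i + 2 = k + 1 - i by omega,
        show k - 1 - i = k + 1 - (i + 2) by omega] at this
    · have := hlt (k - 1) (by omega)
      rwa [show k - 1 + 2 = k + 1 - 0 by omega, show k - 1 = k + 1 - 2 by omega] at this
    · intro u hu i hi
      rw [hrev i hi]
      exact hleaf u hu _ (by omega)

/-- An order satisfying the spine conditions is non-crossing, if each edge joins a spine vertex to
its successor or to a leaf. -/
theorem nonCrossing_of_spineOrdered (h : IsTwoLevelOrder lvl adj lt) {k : ℕ} {e : ℕ → α}
    {leaf : α → Prop} (ho : SpineOrdered lvl adj lt k leaf e)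
    (hpath : ∀ i, i + 1 < k → adj (e i) (e (i + 1)))
    (hedge : ∀ a b, adj a b → ∃ i < k, ∃ p, (leaf p ∨ i + 1 < k ∧ p = e (i + 1)) ∧
      adj (e i) p ∧ (a = e i ∧ b = p ∨ a = p ∧ b = e i)) :
    NonCrossing adj lt := by
  obtain ⟨ha, hb, hc, hd⟩ := ho
  have hle : ∀ i j, i ≤ j → j < k → lvl (e i) = lvl (e j) → e i = e j ∨ lt (e i) (e j) := by
    intro i j hij hj hl
    rcases Nat.lt_or_eq_of_le hij with hij | rfl
    · exact Or.inr ((ha i j (by omega) hj hl).1 hij)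
    · exact Or.inl rfl
  have hup : ∀ i p, i + 1 < k → adj (e i) p → (leaf p ∨ i + 1 < k ∧ p = e (i + 1)) →
      p = e (i + 1) ∨ lt p (e (i + 1)) := by
    rintro i p hi hp (hl | ⟨-, hl⟩)
    · right
      rcases Nat.eq_zero_or_pos i with rfl | hi0
      · exact hc p hp hl
      · exact (hb i hi0 hi p hp hl).2
    · exact Or.inl hl
  have hdown : ∀ j q, 1 ≤ j → j < k → adj (e j) q → (leaf q ∨ j + 1 < k ∧ q = e (j + 1)) →
      lt (e (j - 1)) q := by
    rintro j q hj hjk hq (hl | ⟨hj', rfl⟩)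
    · rcases Nat.lt_or_ge (j + 1) k with hj' | hj'
      · exact (hb j hj hj' q hq hl).1
      · obtain rfl : j = k - 1 := by omega
        exact hd q hq hl
    · refine (ha _ _ (by omega) hj' ?_).1 (by omega)
      have h1 := hpath (j - 1) (by omega)
      rw [Nat.sub_add_cancel hj] at h1
      exact h.lvl_eq_of_adj (h.symm _ _ h1) hq rfl
  have hle_not : ∀ u v, u = v ∨ lt u v → ¬ lt v u := by
    rintro u v (rfl | huv) hvu
    · exact h.irrefl _ hvu
    · exact h.irrefl _ (h.trans _ _ _ huv hvu)
  have hlele : ∀ u v w, u = v ∨ lt u v → v = w ∨ lt v w → u = w ∨ lt u w := by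
    rintro u v w (rfl | huv) (rfl | hvw)
    · exact Or.inl rfl
    · exact Or.inr hvw
    · exact Or.inr huv
    · exact Or.inr (h.trans _ _ _ huv hvw)
  -- Pairs of edges anchored at different spine vertices.
  have key : ∀ i j p q, i < j → j < k → adj (e i) p → adj (e j) q →
      (leaf p ∨ i + 1 < k ∧ p = e (i + 1)) → (leaf q ∨ j + 1 < k ∧ q = e (j + 1)) →
      ¬ lt q p ∧ (¬ (lt (e j) p) ∧ ¬ (lt q (e i))) ∧ ¬ lt (e j) (e i) := by
    intro i j p q hij hj hp hq hp' hq'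
    have h1 := hup i p (by omega) hp hp'
    have h2 := hdown j q (by omega) hj hq hq'
    have hl1 := hpath i (by omega)
    have hl2 := hpath (j - 1) (by omega)
    rw [Nat.sub_add_cancel (by omega)] at hl2
    refine ⟨fun hc => ?_, ⟨fun hc => ?_, fun hc => ?_⟩, fun hc => ?_⟩
    · have hl : lvl (e i) = lvl (e j) :=
        h.lvl_eq_of_adj (h.symm _ _ hp) (h.symm _ _ hq) (h.lvl_eq _ _ hc).symm
      have hne : i + 1 ≠ j := by rintro rfl; exact h.lvl_ne _ _ hl1 hl
      exact hle_not _ _ (hlele _ _ _ h1 (hlele _ _ _ (hle (i + 1) (j - 1) (by omega) (by omega)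
        (h.lvl_eq_of_adj hl1 (h.symm _ _ hl2) hl)) (Or.inr h2))) hc
    · exact hle_not _ _ (hlele _ _ _ h1 (hle _ _ (by omega) hj
        ((h.lvl_eq_of_adj hl1 hp rfl).trans (h.lvl_eq _ _ hc).symm))) hc
    · exact hle_not _ _ (hlele _ _ _ (hle i (j - 1) (by omega) (by omega)
        ((h.lvl_eq _ _ hc).symm.trans (h.lvl_eq_of_adj hq (h.symm _ _ hl2) rfl))) (Or.inr h2)) hc
    · exact hle_not _ _ (hle i j hij.le hj (h.lvl_eq _ _ hc).symm) hc
  intro a b a' b' hab hab' h1 h2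
  obtain ⟨i, hi, p, hp', hp, hcase⟩ := hedge a b hab
  obtain ⟨j, hj, q, hq', hq, hcase'⟩ := hedge a' b' hab'
  rcases lt_trichotomy i j with hij | rfl | hij
  · obtain ⟨k1, ⟨k2, k3⟩, k4⟩ := key i j p q hij hj hp hq hp' hq'
    rcases hcase with ⟨rfl, rfl⟩ | ⟨rfl, rfl⟩ <;> rcases hcase' with ⟨rfl, rfl⟩ | ⟨rfl, rfl⟩ <;>
      contradiction
  · have n1 := h.lvl_ne _ _ hp
    have n2 := h.lvl_ne _ _ hq
    have n3 := h.lvl_eq _ _ h1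
    have n4 := h.irrefl (e i)
    rcases hcase with ⟨rfl, rfl⟩ | ⟨rfl, rfl⟩ <;> rcases hcase' with ⟨rfl, rfl⟩ | ⟨rfl, rfl⟩
    · exact n4 h1
    · exact n2 n3
    · exact n1 n3.symm
    · exact n4 h2
  · obtain ⟨k1, ⟨k2, k3⟩, k4⟩ := key j i q p hij hi hq hp hq' hp'
    rcases hcase with ⟨rfl, rfl⟩ | ⟨rfl, rfl⟩ <;> rcases hcase' with ⟨rfl, rfl⟩ | ⟨rfl, rfl⟩ <;>
      contradiction

end IsTwoLevelOrder

theorem Adj.symm {G : LevelGraph V} {u v : V} (h : Adj G u v) : Adj G v u :=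
  Or.symm h

theorem two_le_deg_iff {G : LevelGraph V} {v : V} :
    2 ≤ deg G v ↔ ∃ a b, Adj G v a ∧ Adj G v b ∧ a ≠ b := by
  have h : 2 ≤ deg G v ↔ Nontrivial {u : V // Adj G v u} := Finite.one_lt_card_iff_nontrivial
  rw [h, nontrivial_iff]
  constructor
  · rintro ⟨⟨a, ha⟩, ⟨b, hb⟩, hab⟩
    exact ⟨a, b, ha, hb, fun h => hab (Subtype.ext h)⟩
  · rintro ⟨a, b, ha, hb, hab⟩
    exact ⟨⟨a, ha⟩, ⟨b, hb⟩, fun h => hab (congrArg Subtype.val h)⟩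

theorem exists_adj_ne_of_two_le_deg {G : LevelGraph V} {v : V} (h : 2 ≤ deg G v) (z : V) :
    ∃ w, Adj G v w ∧ w ≠ z := by
  obtain ⟨a, b, ha, hb, hab⟩ := two_le_deg_iff.1 h
  by_cases haz : a = z
  · exact ⟨b, hb, fun hbz => hab (haz.trans hbz.symm)⟩
  · exact ⟨a, ha, haz⟩

/-- In a connected graph on at least three vertices, every edge has an end of degree at least 2. -/
theorem two_le_deg_or_of_adj {G : LevelGraph V} (hcard : 3 ≤ Fintype.card V)
    (hconn : (SimpleGraph.fromRel G.Edge).Connected) {a b : V} (hab : Adj G a b) :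
    2 ≤ deg G a ∨ 2 ≤ deg G b := by
  by_contra! hcon
  obtain ⟨ha, hb⟩ := hcon
  have hclosed : ∀ v, v = a ∨ v = b := by
    intro v
    have := (SimpleGraph.reachable_iff_reflTransGen a v).1 (hconn.preconnected a v)
    induction this with
    | refl => exact Or.inl rfl
    | @tail c d _ hcd ih =>
      have hcd' : Adj G c d := ((SimpleGraph.fromRel_adj _ _ _).1 hcd).2
      rcases ih with rfl | rfl
      · right
        by_contra hne
        exact absurd (two_le_deg_iff.2 ⟨d, b, hcd', hab, hne⟩) (by omega)
      · left
        by_contra hne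
        exact absurd (two_le_deg_iff.2 ⟨d, a, hcd', hab.symm, hne⟩) (by omega)
  have h1 : (Finset.univ : Finset V) ⊆ {a, b} := fun v _ => by
    simpa using hclosed v
  have h2 := (Finset.card_le_card h1).trans Finset.card_le_two
  rw [Finset.card_univ] at h2
  omega

/-- Two edges between the same levels do not cross in a level planar drawing. -/
theorem LevelDrawing.not_cross {G : LevelGraph V} (D : LevelDrawing G) {a b a' b' : V}
    (hab : G.Edge a b) (hab' : G.Edge a' b') (hl : G.lvl a = G.lvl a') (hl' : G.lvl b = G.lvl b')
    (hx : D.x a < D.x a') : ¬ D.x b' < D.x b := by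
  intro hx'
  have hlt := G.edge_lt _ _ hab
  have hle : (G.lvl a : ℝ) ≤ G.lvl b := by exact_mod_cast hlt.le
  have hc' := D.f_cont _ _ hab'
  have hs' := D.f_src _ _ hab'
  have ht' := D.f_tgt _ _ hab'
  rw [← hl, ← hl'] at hc'
  rw [← hl] at hs'
  rw [← hl'] at ht'
  obtain ⟨t, ht, h0⟩ := intermediate_value_Icc hle ((D.f_cont _ _ hab).sub hc')
    (show (0 : ℝ) ∈ _ by
      simp only [Pi.sub_apply, D.f_src _ _ hab, D.f_tgt _ _ hab, hs', ht', Set.mem_Icc]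
      constructor <;> linarith)
  obtain ⟨w, h1, h2, -, -⟩ := D.planar a b a' b' hab hab'
    (fun h => hx.ne (congrArg D.x (Prod.ext_iff.1 h).1)) t ht (by rwa [← hl, ← hl'])
    (sub_eq_zero.1 h0)
  rcases h1 with rfl | rfl <;> rcases h2 with rfl | rfl
  · exact hx.false
  · omega
  · omega
  · exact hx'.false

theorem LevelGraph.lvl_eq_one_or_two {G : LevelGraph V} (hh : G.h = 2) (v : V) :
    G.lvl v = 1 ∨ G.lvl v = 2 := by
  have := G.lvl_one_le v
  have := G.lvl_le v
  omega

/-- Non-crossing positions on two levels are realized by a straight-line drawing. -/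
theorem exists_levelDrawing {G : LevelGraph V} (hh : G.h = 2) (x : V → ℝ)
    (hinj : ∀ u v, G.lvl u = G.lvl v → x u = x v → u = v)
    (hnc : ∀ a b a' b', G.Edge a b → G.Edge a' b' → x a < x a' → ¬ x b' < x b) :
    ∃ D : LevelDrawing G, D.x = x := by
  refine ⟨{ x := x
            f := fun u v t => (2 - t) * x u + (t - 1) * x v
            x_inj := hinj
            f_cont := fun u v _ => by fun_prop
            f_src := fun u v h => ?_
            f_tgt := fun u v h => ?_
            planar := ?_
            no_through := ?_ }, rfl⟩
  · simp only [(LevelGraph.lvl_of_edge hh h).1]; push_cast; ring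
  · simp only [(LevelGraph.lvl_of_edge hh h).2]; push_cast; ring
  · intro u v u' v' h h' hne t ht _ heq
    obtain ⟨hu, hv⟩ := LevelGraph.lvl_of_edge hh h
    obtain ⟨hu', hv'⟩ := LevelGraph.lvl_of_edge hh h'
    rw [hu, hv] at ht
    obtain ⟨ht1, ht2⟩ := ht
    push_cast at ht1 ht2
    rcases eq_or_lt_of_le ht1 with rfl | ht1
    · have : u = u' := hinj _ _ (by omega) (by linarith)
      exact ⟨u, Or.inl rfl, Or.inl this, by rw [hu]; simp, by ring⟩
    rcases eq_or_lt_of_le ht2 with rfl | ht2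
    · have : v = v' := hinj _ _ (by omega) (by linarith)
      exact ⟨v, Or.inr rfl, Or.inr this, by rw [hv]; simp, by ring⟩
    exfalso
    have n1 := hnc _ _ _ _ h h'
    have n2 := hnc _ _ _ _ h' h
    have p1 : 0 < 2 - t := by linarith
    have p2 : 0 < t - 1 := by linarith
    rcases lt_trichotomy (x u) (x u') with hx | hx | hx
    · have := n1 hx
      nlinarith
    · have hx' : x v = x v' := by
        rw [hx] at heq
        exact mul_left_cancel₀ p2.ne' (add_left_cancel heq)
      exact hne (Prod.ext (hinj u u' (hu.trans hu'.symm) hx) (hinj v v' (hv.trans hv'.symm) hx'))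
    · have := n2 hx
      nlinarith
  · intro u v w h hwu hwv _ _ heq
    obtain ⟨hu, hv⟩ := LevelGraph.lvl_of_edge hh h
    rcases LevelGraph.lvl_eq_one_or_two hh w with hw | hw
    · refine hwu (hinj _ _ (by omega) ?_)
      rw [← heq, hw]; push_cast; ring
    · refine hwv (hinj _ _ (by omega) ?_)
      rw [← heq, hw]; push_cast; ring

/-- A two-level order on a finite set is represented by real coordinates. -/
theorem IsTwoLevelOrder.exists_coordinate {lvl : V → ℕ} {adj lt : V → V → Prop}
    (h : IsTwoLevelOrder lvl adj lt) :
    ∃ x : V → ℝ, ∀ u v, lvl u = lvl v → (lt u v ↔ x u < x v) := by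
  have hmono : ∀ u v, lt u v →
      (Finset.univ.filter (lt · u)).card < (Finset.univ.filter (lt · v)).card := by
    intro u v huv
    refine Finset.card_lt_card (Finset.ssubset_iff_of_subset ?_ |>.2 ⟨u, ?_, ?_⟩)
    · intro w hw
      simp only [Finset.mem_filter, Finset.mem_univ, true_and] at hw ⊢
      exact h.trans _ _ _ hw huv
    · simpa using huv
    · simpa using h.irrefl u
  refine ⟨fun v => ((Finset.univ.filter (lt · v)).card : ℝ), fun u v hl => ?_⟩
  rw [Nat.cast_lt]
  refine ⟨hmono u v, fun hlt => ?_⟩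
  by_contra hcon
  by_cases huv : u = v
  · subst huv; exact hlt.false
  · exact (hmono v u ((h.total u v hl huv).resolve_left hcon)).asymm hlt

/-- The order of a level planar drawing is non-crossing, and every non-crossing order arises. -/
theorem exists_levelDrawing_iff_nonCrossing {G : LevelGraph V} (hh : G.h = 2)
    {lt : V → V → Prop} (h : IsTwoLevelOrder G.lvl (Adj G) lt) :
    (∃ D : LevelDrawing G, ∀ u v, G.lvl u = G.lvl v → (lt u v ↔ D.x u < D.x v)) ↔
      NonCrossing (Adj G) lt := by
  constructor
  · rintro ⟨D, hD⟩ a b a' b' hab hab' hlt hlt'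
    have hla := h.lvl_eq _ _ hlt
    have hlb := h.lvl_eq _ _ hlt'
    have hxa := (hD _ _ hla).1 hlt
    have hxb := (hD _ _ hlb).1 hlt'
    rcases hab with hab | hab <;> rcases hab' with hab' | hab'
    · exact D.not_cross hab hab' hla hlb.symm hxa hxb
    · have := LevelGraph.lvl_of_edge hh hab
      have := LevelGraph.lvl_of_edge hh hab'
      omega
    · have := LevelGraph.lvl_of_edge hh hab
      have := LevelGraph.lvl_of_edge hh hab'
      omega
    · exact D.not_cross hab' hab hlb hla.symm hxb hxa
  · intro hnc
    obtain ⟨x, hx⟩ := h.exists_coordinate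
    obtain ⟨D, rfl⟩ := exists_levelDrawing hh x
      (fun u v hl hxuv => by
        by_contra hne
        rcases h.total u v hl hne with hlt | hlt
        · exact ((hx _ _ hl).1 hlt).ne hxuv
        · exact ((hx _ _ hl.symm).1 hlt).ne hxuv.symm)
      (fun a b a' b' hab hab' hxa hxb => by
        have h1 := LevelGraph.lvl_of_edge hh hab
        have h2 := LevelGraph.lvl_of_edge hh hab'
        exact hnc a b a' b' (Or.inl hab) (Or.inl hab') ((hx _ _ (by omega)).2 hxa)
          ((hx _ _ (by omega)).2 hxb))
    exact ⟨D, hx⟩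

/-- Characterization of the vertex orders realized by level
planar drawings of a connected caterpillar on two levels.  Let the spine be
`sp 0, …, sp (k-1)` (the induced path on the vertices of degree at least 2,
`k ≥ 2`), and let `r1`, `r2` be linear orders on the two levels.  The pair
`(r1, r2)` arises as the left-to-right vertex order of a level planar drawing
iff, after possibly reversing the spine enumeration (`e`), the conditions
(a)–(d) below hold. -/
theorem caterpillar_two_level_orders (G : LevelGraph V) (hh : G.h = 2)
    (hcard : 3 ≤ Fintype.card V)
    (hcat : IsCaterpillar (SimpleGraph.fromRel G.Edge))
    (k : ℕ) (hk : 2 ≤ k) (sp : ℕ → V)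
    (hspine : ∀ v, 2 ≤ deg G v ↔ ∃ i < k, v = sp i)
    (hsp_inj : ∀ i j, i < k → j < k → sp i = sp j → i = j)
    (hsp_path : ∀ i, i + 1 < k → Adj G (sp i) (sp (i + 1)))
    (hsp_induced : ∀ i j, i < k → j < k → Adj G (sp i) (sp j) →
      (i = j + 1 ∨ j = i + 1))
    (r1 r2 : V → V → Prop)
    (hr1_lvl : ∀ u v, r1 u v → G.lvl u = 1 ∧ G.lvl v = 1)
    (hr2_lvl : ∀ u v, r2 u v → G.lvl u = 2 ∧ G.lvl v = 2)
    (hr1_irrefl : ∀ v, ¬ r1 v v) (hr2_irrefl : ∀ v, ¬ r2 v v)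
    (hr1_trans : ∀ a b c, r1 a b → r1 b c → r1 a c)
    (hr2_trans : ∀ a b c, r2 a b → r2 b c → r2 a c)
    (hr1_total : ∀ u v, G.lvl u = 1 → G.lvl v = 1 → u ≠ v → r1 u v ∨ r1 v u)
    (hr2_total : ∀ u v, G.lvl u = 2 → G.lvl v = 2 → u ≠ v → r2 u v ∨ r2 v u) :
    (∃ D : LevelDrawing G,
        (∀ u v, G.lvl u = 1 → G.lvl v = 1 → (r1 u v ↔ D.x u < D.x v)) ∧
        (∀ u v, G.lvl u = 2 → G.lvl v = 2 → (r2 u v ↔ D.x u < D.x v))) ↔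
      (∃ e : ℕ → V,
        ((∀ i, i < k → e i = sp i) ∨ (∀ i, i < k → e i = sp (k - 1 - i))) ∧
        -- (a) spine vertices on a common level appear in spine order
        (∀ i j, i < k → j < k → G.lvl (e i) = G.lvl (e j) →
          (i < j ↔ (r1 (e i) (e j) ∨ r2 (e i) (e j)))) ∧
        -- (b) non-spine neighbors of an inner spine vertex lie strictly
        -- between its two spine neighbors
        (∀ i, 1 ≤ i → i + 1 < k → ∀ u, Adj G (e i) u → (∀ l, l < k → u ≠ sp l) →
          ((r1 (e (i - 1)) u ∨ r2 (e (i - 1)) u) ∧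
            (r1 u (e (i + 1)) ∨ r2 u (e (i + 1))))) ∧
        -- (c) non-spine neighbors of the first spine vertex precede the second
        (∀ u, Adj G (e 0) u → (∀ l, l < k → u ≠ sp l) →
          (r1 u (e 1) ∨ r2 u (e 1))) ∧
        -- (d) the (k-1)-st spine vertex precedes the non-spine neighbors of the last
        (∀ u, Adj G (e (k - 1)) u → (∀ l, l < k → u ≠ sp l) →
          (r1 (e (k - 2)) u ∨ r2 (e (k - 2)) u))) := by
  have hlvl : ∀ u v, Adj G u v → G.lvl u ≠ G.lvl v := by
    rintro u v (h | h)
    · exact (G.edge_lt _ _ h).ne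
    · exact (G.edge_lt _ _ h).ne'
  have hord : IsTwoLevelOrder G.lvl (Adj G) (fun u v => r1 u v ∨ r2 u v) :=
    { symm := fun _ _ h => h.symm
      lvl_ne := hlvl
      two := LevelGraph.lvl_eq_one_or_two hh
      irrefl := fun v h => h.elim (hr1_irrefl v) (hr2_irrefl v)
      trans := by
        rintro u v w (h | h) (h' | h')
        · exact Or.inl (hr1_trans _ _ _ h h')
        · have := hr1_lvl _ _ h
          have := hr2_lvl _ _ h'
          omega
        · have := hr2_lvl _ _ h
          have := hr1_lvl _ _ h'
          omega
        · exact Or.inr (hr2_trans _ _ _ h h')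
      lvl_eq := by
        rintro u v (h | h)
        · have := hr1_lvl _ _ h
          omega
        · have := hr2_lvl _ _ h
          omega
      total := by
        intro u v hl hne
        rcases LevelGraph.lvl_eq_one_or_two hh u with hu | hu
        · exact (hr1_total u v hu (by omega) hne).imp Or.inl Or.inl
        · exact (hr2_total u v hu (by omega) hne).imp Or.inr Or.inr }
  have hdraw : (∃ D : LevelDrawing G,
      (∀ u v, G.lvl u = 1 → G.lvl v = 1 → (r1 u v ↔ D.x u < D.x v)) ∧
      (∀ u v, G.lvl u = 2 → G.lvl v = 2 → (r2 u v ↔ D.x u < D.x v))) ↔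
      ∃ D : LevelDrawing G, ∀ u v, G.lvl u = G.lvl v → ((r1 u v ∨ r2 u v) ↔ D.x u < D.x v) := by
    have hnot1 : ∀ u v, G.lvl u = 2 → ¬ r1 u v := fun u v hu hr => by
      have := hr1_lvl _ _ hr
      omega
    have hnot2 : ∀ u v, G.lvl u = 1 → ¬ r2 u v := fun u v hu hr => by
      have := hr2_lvl _ _ hr
      omega
    refine exists_congr fun D => ⟨fun ⟨h1, h2⟩ u v hl => ?_, fun h => ⟨fun u v hu hv => ?_,
      fun u v hu hv => ?_⟩⟩
    · rcases LevelGraph.lvl_eq_one_or_two hh u with hu | hu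
      · rw [← h1 u v hu (by omega), or_iff_left (hnot2 u v hu)]
      · rw [← h2 u v hu (by omega), or_iff_right (hnot1 u v hu)]
    · rw [← h u v (by omega), or_iff_left (hnot2 u v hu)]
    · rw [← h u v (by omega), or_iff_right (hnot1 u v hu)]
  rw [hdraw, exists_levelDrawing_iff_nonCrossing hh hord]
  constructor
  · intro hnc
    exact hord.exists_spineOrdered (leaf := fun u => ∀ l, l < k → u ≠ sp l) hnc hk hsp_inj hsp_path
      (fun _ hu => hu)
      (exists_adj_ne_of_two_le_deg ((hspine _).2 ⟨0, by omega, rfl⟩) _)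
      (exists_adj_ne_of_two_le_deg ((hspine _).2 ⟨k - 1, by omega, rfl⟩) _)
  · rintro ⟨e, he, hso⟩
    have hspine' : ∀ v, 2 ≤ deg G v → ∃ i < k, v = e i := by
      intro v hv
      obtain ⟨i, hi, rfl⟩ := (hspine v).1 hv
      rcases he with he | he
      · exact ⟨i, hi, (he i hi).symm⟩
      · exact ⟨k - 1 - i, by omega, by rw [he _ (by omega)]; congr 1; omega⟩
    have hpath' : ∀ i, i + 1 < k → Adj G (e i) (e (i + 1)) := by
      intro i hi
      rcases he with he | he
      · rw [he i (by omega), he _ hi]; exact hsp_path i hi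
      · rw [he i (by omega), he _ hi]
        have := (hsp_path (k - 1 - (i + 1)) (by omega)).symm
        rwa [show k - 1 - (i + 1) + 1 = k - 1 - i by omega] at this
    have hind' : ∀ i j, i < k → j < k → Adj G (e i) (e j) → i = j + 1 ∨ j = i + 1 := by
      intro i j hi hj hij
      rcases he with he | he
      · rw [he i hi, he j hj] at hij; exact hsp_induced i j hi hj hij
      · rw [he i hi, he j hj] at hij
        have := hsp_induced _ _ (by omega) (by omega) hij
        omega
    have hleaf : ∀ u, ¬ 2 ≤ deg G u → ∀ l, l < k → u ≠ sp l :=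
      fun u hu l hl hul => hu ((hspine u).2 ⟨l, hl, hul⟩)
    refine hord.nonCrossing_of_spineOrdered (leaf := fun u => ∀ l, l < k → u ≠ sp l) hso hpath' ?_
    intro a b hab
    by_cases ha : 2 ≤ deg G a
    · obtain ⟨i, hi, rfl⟩ := hspine' a ha
      by_cases hb : 2 ≤ deg G b
      · obtain ⟨j, hj, rfl⟩ := hspine' b hb
        rcases hind' i j hi hj hab with rfl | rfl
        · exact ⟨j, hj, _, Or.inr ⟨hi, rfl⟩, hab.symm, Or.inr ⟨rfl, rfl⟩⟩
        · exact ⟨i, hi, _, Or.inr ⟨hj, rfl⟩, hab, Or.inl ⟨rfl, rfl⟩⟩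
      · exact ⟨i, hi, b, Or.inl (hleaf b hb), hab, Or.inl ⟨rfl, rfl⟩⟩
    · have hb := (two_le_deg_or_of_adj hcard hcat.1 hab).resolve_left ha
      obtain ⟨j, hj, rfl⟩ := hspine' b hb
      exact ⟨j, hj, a, Or.inl (hleaf a ha), hab.symm, Or.inr ⟨rfl, rfl⟩⟩
end
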